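/- Let N ≥ 4 be a real number, T > 0, n ∈ ℕ, M > 0. Let b₂, b₁, b₀ ∈ C^∞([0,T]×[0,1]) satisfy |b₂ − 1| ≤ 1/2 everywhere and |b⃗|₆^T ≤ M, where b⃗ = (b₂,b₁,b₀). Let τ₂ ∈ (0,T), let G ∈ C^∞([0,T]×[0,1]) vanish for 0 ≤ t ≤ τ₂, and let H ∈ C^∞([0,T]×[0,1]) satisfy ∂_t²H + 𝒜H = G on [0,T]×(0,1), H(t,1) = 0 for all t, and H(t,·) = 0 for 0 ≤ t ≤ τ₂. Then there is a constant C = C(n, M, N, T) such that for all t ∈ [0,T]: Z_{n+2}(H)(t) ≤ C·( Z_{n+1}(∂_t H)(t) + ‖G(t,·)‖_n + (1 + |b⃗(t,·)|_{n+4})·‖H(t,·)‖₁ ). -/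

import Mathlib

open MeasureTheory Real Set

noncomputable section

/-- The degenerate operator `Δy(z) = z y''(z) + (N/2) y'(z)`. -/
def Del (N : ℝ) (f : ℝ → ℝ) : ℝ → ℝ :=
  fun z => z * deriv (deriv f) z + (N / 2) * deriv f z

/-- Iterates `Δ^m`. -/
def DelIter (N : ℝ) : ℕ → (ℝ → ℝ) → ℝ → ℝ
  | 0 => fun f => f
  | m + 1 => fun f => Del N (DelIter N m f)

/-- `Ḋ = √z d/dz`. -/
def Ddot (f : ℝ → ℝ) : ℝ → ℝ := fun z => Real.sqrt z * deriv f z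

/-- The weighted L² norm on (0,1). -/
def Xnorm (N : ℝ) (f : ℝ → ℝ) : ℝ :=
  Real.sqrt (∫ z in (0:ℝ)..1, (f z) ^ 2 * z ^ (N / 2 - 1))

/-- Graded seminorms `(y)_ℓ`. -/
def gnorm (N : ℝ) (ℓ : ℕ) (f : ℝ → ℝ) : ℝ :=
  if ℓ % 2 = 0 then Xnorm N (DelIter N (ℓ / 2) f)
  else Xnorm N (Ddot (DelIter N (ℓ / 2) f))

/-- Graded norm `‖y‖_n`. -/
def normN (N : ℝ) (n : ℕ) (f : ℝ → ℝ) : ℝ :=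
  Real.sqrt (∑ ℓ ∈ Finset.range (n + 1), (gnorm N ℓ f) ^ 2)

/-- Sup norm on [0,1]. -/
def supN (f : ℝ → ℝ) : ℝ := ⨆ z : Icc (0:ℝ) 1, |f z.1|

/-- `|y|_n = ∑_{ℓ≤n} ‖Ḋ^ℓ y‖_{L^∞(0,1)}`. -/
def supLow (n : ℕ) (f : ℝ → ℝ) : ℝ := ∑ ℓ ∈ Finset.range (n + 1), supN (Ddot^[ℓ] f)

/-- Time derivative of a function of (t,z). -/
def dt (y : ℝ → ℝ → ℝ) : ℝ → ℝ → ℝ := fun t z => deriv (fun s => y s z) t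

/-- Sup norm on [0,T]×[0,1]. -/
def supT (T : ℝ) (y : ℝ → ℝ → ℝ) : ℝ :=
  ⨆ (t : Icc (0:ℝ) T) (z : Icc (0:ℝ) 1), |y t.1 z.1|

/-- `|y|_n^T = sup_{j+k≤n} ‖∂_t^j Ḋ^k y‖_{L^∞([0,T]×[0,1])}`. -/
def supNT (T : ℝ) (n : ℕ) (y : ℝ → ℝ → ℝ) : ℝ :=
  ⨆ p : {p : ℕ × ℕ // p.1 + p.2 ≤ n}, supT T (fun t => Ddot^[p.1.2] (dt^[p.1.1] y t))

/-- `‖y‖_n^T`. -/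
def normT (N T : ℝ) (n : ℕ) (y : ℝ → ℝ → ℝ) : ℝ :=
  Real.sqrt (∑ j ∈ Finset.range (n + 1), ∑ k ∈ Finset.range (n + 1 - j),
    ∫ t in (0:ℝ)..T, (normN N k (dt^[j] y t)) ^ 2)

/-- `Z_n(H)(t) = ∑_{j+k=n} ‖∂_t^j H(t,·)‖_k`. -/
def ZZ (N : ℝ) (n : ℕ) (H : ℝ → ℝ → ℝ) (t : ℝ) : ℝ :=
  ∑ j ∈ Finset.range (n + 1), normN N (n - j) (dt^[j] H t)

/-- The operator `𝒜h = -b₂ Δh + b₁ Ďh + b₀ h` with time-dependent coefficients. -/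
def opA (N : ℝ) (b₂ b₁ b₀ : ℝ → ℝ → ℝ) (H : ℝ → ℝ → ℝ) : ℝ → ℝ → ℝ :=
  fun t z => -(b₂ t z) * Del N (H t) z + b₁ t z * (z * deriv (H t) z) + b₀ t z * H t z

end



/-! ### Weighted `L²` norm basics -/

lemma wcont {N : ℝ} (hN : 2 ≤ N) : Continuous (fun z : ℝ => z ^ (N / 2 - 1)) :=
  Real.continuous_rpow_const (by linarith)

lemma X_nonneg (N : ℝ) (f : ℝ → ℝ) : 0 ≤ Xnorm N f := Real.sqrt_nonneg _

lemma X_sq (N : ℝ) (f : ℝ → ℝ) :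
    Xnorm N f ^ 2 = ∫ z in (0:ℝ)..1, (f z) ^ 2 * z ^ (N / 2 - 1) := by
  unfold Xnorm
  rw [Real.sq_sqrt]
  apply intervalIntegral.integral_nonneg (by norm_num)
  intro u hu
  have := Real.rpow_nonneg hu.1 (N / 2 - 1)
  positivity

lemma X_cs {N : ℝ} (hN : 2 ≤ N) {f g : ℝ → ℝ} (hf : Continuous f) (hg : Continuous g) :
    |∫ z in (0:ℝ)..1, f z * g z * z ^ (N / 2 - 1)| ≤ Xnorm N f * Xnorm N g := by
  have hw := wcont hN
  set A := ∫ z in (0:ℝ)..1, f z * g z * z ^ (N / 2 - 1) with hA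
  have key : ∀ x : ℝ, 0 ≤ Xnorm N g ^ 2 * (x * x) + (2 * A) * x + Xnorm N f ^ 2 := by
    intro x
    have h1 : (∫ z in (0:ℝ)..1, (f z + x * g z) ^ 2 * z ^ (N / 2 - 1))
        = Xnorm N g ^ 2 * (x * x) + (2 * A) * x + Xnorm N f ^ 2 := by
      have i1 : IntervalIntegrable (fun z => (f z) ^ 2 * z ^ (N / 2 - 1)) volume 0 1 :=
        Continuous.intervalIntegrable (by fun_prop) _ _
      have i2 : IntervalIntegrable (fun z => (2 * x) * (f z * g z * z ^ (N / 2 - 1))) volume 0 1 :=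
        Continuous.intervalIntegrable (by fun_prop) _ _
      have i3 : IntervalIntegrable (fun z => (x * x) * ((g z) ^ 2 * z ^ (N / 2 - 1))) volume 0 1 :=
        Continuous.intervalIntegrable (by fun_prop) _ _
      have : (fun z => (f z + x * g z) ^ 2 * z ^ (N / 2 - 1))
          = fun z => (f z) ^ 2 * z ^ (N / 2 - 1) + (2 * x) * (f z * g z * z ^ (N / 2 - 1))
            + (x * x) * ((g z) ^ 2 * z ^ (N / 2 - 1)) := by
        funext z; ring
      rw [this, intervalIntegral.integral_add (i1.add i2) i3, intervalIntegral.integral_add i1 i2,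
        intervalIntegral.integral_const_mul, intervalIntegral.integral_const_mul, X_sq, X_sq, ← hA]
      ring
    rw [← h1]
    apply intervalIntegral.integral_nonneg (by norm_num)
    intro u hu
    have := Real.rpow_nonneg hu.1 (N / 2 - 1)
    positivity
  have hd := discrim_le_zero key
  unfold discrim at hd
  apply abs_le_of_sq_le_sq _ (mul_nonneg (X_nonneg _ _) (X_nonneg _ _))
  nlinarith

lemma X_add {N : ℝ} (hN : 2 ≤ N) {f g : ℝ → ℝ} (hf : Continuous f) (hg : Continuous g) :
    Xnorm N (fun z => f z + g z) ≤ Xnorm N f + Xnorm N g := by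
  have hw := wcont hN
  have hcs := X_cs hN hf hg
  set A := ∫ z in (0:ℝ)..1, f z * g z * z ^ (N / 2 - 1) with hA
  have h1 : Xnorm N (fun z => f z + g z) ^ 2 = Xnorm N f ^ 2 + 2 * A + Xnorm N g ^ 2 := by
    have i1 : IntervalIntegrable (fun z => (f z) ^ 2 * z ^ (N / 2 - 1)) volume 0 1 :=
      Continuous.intervalIntegrable (by fun_prop) _ _
    have i2 : IntervalIntegrable (fun z => 2 * (f z * g z * z ^ (N / 2 - 1))) volume 0 1 :=
      Continuous.intervalIntegrable (by fun_prop) _ _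
    have i3 : IntervalIntegrable (fun z => ((g z) ^ 2 * z ^ (N / 2 - 1))) volume 0 1 :=
      Continuous.intervalIntegrable (by fun_prop) _ _
    rw [X_sq]
    have : (fun z => (f z + g z) ^ 2 * z ^ (N / 2 - 1))
        = fun z => (f z) ^ 2 * z ^ (N / 2 - 1) + 2 * (f z * g z * z ^ (N / 2 - 1))
          + ((g z) ^ 2 * z ^ (N / 2 - 1)) := by
      funext z; ring
    rw [this, intervalIntegral.integral_add (i1.add i2) i3, intervalIntegral.integral_add i1 i2,
      intervalIntegral.integral_const_mul, X_sq, X_sq, ← hA]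
  have h2 := (abs_le.1 hcs).2
  apply le_of_sq_le_sq _ (add_nonneg (X_nonneg _ _) (X_nonneg _ _))
  rw [h1]
  nlinarith

lemma X_mono {N : ℝ} (hN : 2 ≤ N) {f g : ℝ → ℝ} (hf : Continuous f) (hg : Continuous g)
    {C : ℝ} (hC : 0 ≤ C) (h : ∀ z ∈ Ioo (0:ℝ) 1, |f z| ≤ C * |g z|) :
    Xnorm N f ≤ C * Xnorm N g := by
  have hw := wcont hN
  apply le_of_sq_le_sq _ (mul_nonneg hC (X_nonneg _ _))
  rw [mul_pow, X_sq, X_sq, ← intervalIntegral.integral_const_mul]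
  apply intervalIntegral.integral_mono_on_of_le_Ioo (by norm_num)
  · exact Continuous.intervalIntegrable (by fun_prop) _ _
  · exact Continuous.intervalIntegrable (by fun_prop) _ _
  · intro z hz
    have h0 := Real.rpow_nonneg hz.1.le (N / 2 - 1)
    have h1 := h z hz
    have h2 : f z ^ 2 ≤ C ^ 2 * g z ^ 2 := by
      rw [← sq_abs (f z), ← sq_abs (g z), ← mul_pow]
      exact pow_le_pow_left₀ (abs_nonneg _) h1 2
    rw [← mul_assoc]
    exact mul_le_mul_of_nonneg_right h2 h0

lemma X_congr (N : ℝ) {f g : ℝ → ℝ} (h : ∀ z ∈ Ioo (0:ℝ) 1, f z = g z) :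
    Xnorm N f = Xnorm N g := by
  unfold Xnorm
  congr 1
  apply intervalIntegral.integral_congr_ae
  have : ∀ᵐ x : ℝ, x ≠ 1 := by
    simp [ae_iff]
  filter_upwards [this] with x hx hx2
  rw [uIoc_of_le (by norm_num)] at hx2
  rw [h x ⟨hx2.1, lt_of_le_of_ne hx2.2 hx⟩]

lemma X_shift {N : ℝ} (a : ℕ) (f : ℝ → ℝ) :
    Xnorm N (fun z => Real.sqrt z ^ a * f z) = Xnorm (N + 2 * a) f := by
  unfold Xnorm
  congr 1
  apply intervalIntegral.integral_congr_ae
  filter_upwards with x hx2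
  rw [uIoc_of_le (by norm_num)] at hx2
  have hx := hx2.1
  have h1 : (Real.sqrt x ^ a) ^ 2 = x ^ a := by
    rw [← pow_mul, mul_comm, pow_mul, Real.sq_sqrt hx.le]
  have h2 : x ^ ((N + 2 * a) / 2 - 1) = x ^ (N / 2 - 1) * x ^ a := by
    rw [← Real.rpow_natCast x a, ← Real.rpow_add hx]
    congr 1; ring
  rw [mul_pow, h1, h2]; ring

/-! ### Smooth functions -/

def Sm (f : ℝ → ℝ) : Prop := ContDiff ℝ (⊤ : ℕ∞) f

lemma Sm.cont {f : ℝ → ℝ} (h : Sm f) : Continuous f := ContDiff.continuous h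

lemma Sm.diff {f : ℝ → ℝ} (h : Sm f) : Differentiable ℝ f :=
  (contDiff_infty_iff_deriv.1 h).1

lemma Sm.deriv {f : ℝ → ℝ} (h : Sm f) : Sm (deriv f) :=
  (contDiff_infty_iff_deriv.1 h).2

lemma Sm.hd {f : ℝ → ℝ} (h : Sm f) (z : ℝ) : HasDerivAt f (_root_.deriv f z) z :=
  (h.diff z).hasDerivAt

lemma Sm.add {f g : ℝ → ℝ} (h : Sm f) (h' : Sm g) : Sm (fun z => f z + g z) := ContDiff.add h h'

lemma Sm.mul {f g : ℝ → ℝ} (h : Sm f) (h' : Sm g) : Sm (fun z => f z * g z) := ContDiff.mul h h'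

lemma Sm.sub {f g : ℝ → ℝ} (h : Sm f) (h' : Sm g) : Sm (fun z => f z - g z) := ContDiff.sub h h'

lemma Sm.const (c : ℝ) : Sm (fun _ => c) := contDiff_const

lemma Sm.pow (p : ℕ) : Sm (fun z => z ^ p) := contDiff_id.pow p

lemma Sm.id : Sm (fun z => z) := contDiff_id

lemma Sm.iter {f : ℝ → ℝ} (h : Sm f) (k : ℕ) : Sm (_root_.deriv^[k] f) := by
  induction k with
  | zero => exact h
  | succ k ih => rw [Function.iterate_succ_apply']; exact ih.deriv

lemma Sm.del {f : ℝ → ℝ} (N : ℝ) (h : Sm f) : Sm (Del N f) :=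
  (Sm.id.mul h.deriv.deriv).add ((Sm.const _).mul h.deriv)

lemma Sm.delIter {f : ℝ → ℝ} (N : ℝ) (m : ℕ) (h : Sm f) : Sm (DelIter N m f) := by
  induction m with
  | zero => exact h
  | succ k ih => exact ih.del N

lemma Sm.ddot {f : ℝ → ℝ} (h : Sm f) : Continuous (Ddot f) :=
  Real.continuous_sqrt.mul h.deriv.cont

lemma Del_add (N : ℝ) {f g : ℝ → ℝ} (hf : Sm f) (hg : Sm g) (z : ℝ) :
    Del N (fun z => f z + g z) z = Del N f z + Del N g z := by
  have e1 : deriv (fun z => f z + g z) = fun z => deriv f z + deriv g z := by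
    funext z; exact ((hf.hd z).add (hg.hd z)).deriv
  have e2 : deriv (fun z => deriv f z + deriv g z) = fun z => deriv (deriv f) z + deriv (deriv g) z := by
    funext z; exact ((hf.deriv.hd z).add (hg.deriv.hd z)).deriv
  simp only [Del, e1, e2]; ring

lemma Del_smul (N : ℝ) (c : ℝ) {f : ℝ → ℝ} (hf : Sm f) (z : ℝ) :
    Del N (fun z => c * f z) z = c * Del N f z := by
  have e1 : deriv (fun z => c * f z) = fun z => c * deriv f z := by
    funext z; exact ((hf.hd z).const_mul c).deriv
  have e2 : deriv (fun z => c * deriv f z) = fun z => c * deriv (deriv f) z := by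
    funext z; exact ((hf.deriv.hd z).const_mul c).deriv
  simp only [Del, e1, e2]; ring

lemma Del_mul (N : ℝ) {f g : ℝ → ℝ} (hf : Sm f) (hg : Sm g) (z : ℝ) :
    Del N (fun z => f z * g z) z
      = f z * Del N g z + 2 * z * deriv f z * deriv g z + Del N f z * g z := by
  have e1 : deriv (fun z => f z * g z) = fun z => deriv f z * g z + f z * deriv g z := by
    funext z; exact ((hf.hd z).mul (hg.hd z)).deriv
  have e2 : deriv (fun z => deriv f z * g z + f z * deriv g z)
      = fun z => (deriv (deriv f) z * g z + deriv f z * deriv g z)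
        + (deriv f z * deriv g z + f z * deriv (deriv g) z) := by
    funext z
    exact (((hf.deriv.hd z).mul (hg.hd z)).add ((hf.hd z).mul (hg.deriv.hd z))).deriv
  simp only [Del, e1, e2]; ring

lemma DelIter_add (N : ℝ) (m : ℕ) {f g : ℝ → ℝ} (hf : Sm f) (hg : Sm g) :
    DelIter N m (fun z => f z + g z) = fun z => DelIter N m f z + DelIter N m g z := by
  induction m with
  | zero => rfl
  | succ k ih =>
    funext z
    show Del N (DelIter N k _) z = _
    rw [ih, Del_add N (hf.delIter N k) (hg.delIter N k)]; rfl

lemma DelIter_smul (N : ℝ) (m : ℕ) (c : ℝ) {f : ℝ → ℝ} (hf : Sm f) :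
    DelIter N m (fun z => c * f z) = fun z => c * DelIter N m f z := by
  induction m with
  | zero => rfl
  | succ k ih =>
    funext z
    show Del N (DelIter N k _) z = _
    rw [ih, Del_smul N c (hf.delIter N k)]; rfl

lemma DelIter_succ' (N : ℝ) (m : ℕ) (f : ℝ → ℝ) :
    DelIter N (m + 1) f = DelIter N m (Del N f) := by
  induction m with
  | zero => rfl
  | succ k ih =>
    show Del N (DelIter N (k + 1) f) = Del N (DelIter N k (Del N f))
    rw [ih]

/-- The order-`ℓ` operator whose norm is `gnorm`. -/
noncomputable def DD (N : ℝ) (ℓ : ℕ) (f : ℝ → ℝ) : ℝ → ℝ :=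
  if ℓ % 2 = 0 then DelIter N (ℓ / 2) f else Ddot (DelIter N (ℓ / 2) f)

lemma gnorm_eq (N : ℝ) (ℓ : ℕ) (f : ℝ → ℝ) : gnorm N ℓ f = Xnorm N (DD N ℓ f) := by
  unfold gnorm DD; split_ifs <;> rfl

lemma DD_even (N : ℝ) (m : ℕ) (f : ℝ → ℝ) : DD N (2 * m) f = DelIter N m f := by
  unfold DD
  rw [if_pos (by omega)]; congr 1; omega

lemma DD_odd (N : ℝ) (m : ℕ) (f : ℝ → ℝ) : DD N (2 * m + 1) f = Ddot (DelIter N m f) := by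
  unfold DD
  rw [if_neg (by omega)]; congr 2; omega

lemma DD_cont (N : ℝ) (ℓ : ℕ) {f : ℝ → ℝ} (hf : Sm f) : Continuous (DD N ℓ f) := by
  unfold DD; split_ifs
  · exact (hf.delIter _ _).cont
  · exact (hf.delIter _ _).ddot

lemma DD_add (N : ℝ) (ℓ : ℕ) {f g : ℝ → ℝ} (hf : Sm f) (hg : Sm g) :
    DD N ℓ (fun z => f z + g z) = fun z => DD N ℓ f z + DD N ℓ g z := by
  unfold DD; split_ifs
  · exact DelIter_add _ _ hf hg
  · rw [DelIter_add _ _ hf hg]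
    funext z
    simp only [Ddot]
    rw [(((hf.delIter N _).hd z).fun_add ((hg.delIter N _).hd z)).deriv]; ring

lemma DD_smul (N : ℝ) (ℓ : ℕ) (c : ℝ) {f : ℝ → ℝ} (hf : Sm f) :
    DD N ℓ (fun z => c * f z) = fun z => c * DD N ℓ f z := by
  unfold DD; split_ifs
  · exact DelIter_smul _ _ _ hf
  · rw [DelIter_smul _ _ _ hf]
    funext z
    simp only [Ddot]
    rw [(((hf.delIter N _).hd z).const_mul c).deriv]; ring

lemma DD_add_two (N : ℝ) (ℓ : ℕ) (f : ℝ → ℝ) : DD N (ℓ + 2) f = DD N ℓ (Del N f) := by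
  unfold DD
  have h1 : (ℓ + 2) % 2 = ℓ % 2 := by omega
  have h2 : (ℓ + 2) / 2 = ℓ / 2 + 1 := by omega
  rw [h1, h2, DelIter_succ']

lemma gnorm_add_two (N : ℝ) (ℓ : ℕ) (f : ℝ → ℝ) : gnorm N (ℓ + 2) f = gnorm N ℓ (Del N f) := by
  rw [gnorm_eq, gnorm_eq, DD_add_two]

lemma gnorm_nonneg (N : ℝ) (ℓ : ℕ) (f : ℝ → ℝ) : 0 ≤ gnorm N ℓ f := by
  rw [gnorm_eq]; exact X_nonneg _ _

/-! ### Hardy type inequality -/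

lemma rpow_w {N : ℝ} (hN : 2 ≤ N) {z : ℝ} (hz : 0 ≤ z) : z ^ (N / 2) = z * z ^ (N / 2 - 1) := by
  conv_lhs => rw [show N / 2 = 1 + (N / 2 - 1) by ring]
  rw [Real.rpow_add' hz (by linarith), Real.rpow_one]

lemma hardy_aux {N' N : ℝ} (hN' : 2 ≤ N') (hN : N' ≤ N) {y : ℝ → ℝ} (hy : Sm y) :
    Xnorm N' (fun z => z * deriv (deriv y) z) ≤ Xnorm N' (Del N y) := by
  have hw := wcont hN'
  apply le_of_sq_le_sq _ (X_nonneg _ _)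
  have c1 := hy.deriv.cont
  have c2 := hy.deriv.deriv.cont
  have hF : ∀ z ∈ uIcc (0:ℝ) 1, HasDerivAt (fun z => z ^ (N' / 2) * deriv y z ^ 2)
      (N' / 2 * (deriv y z ^ 2 * z ^ (N' / 2 - 1))
        + 2 * (z * deriv y z * deriv (deriv y) z * z ^ (N' / 2 - 1))) z := by
    intro z hz
    rw [uIcc_of_le (by norm_num)] at hz
    have h1 := (Real.hasDerivAt_rpow_const (x := z) (p := N' / 2) (Or.inr (by linarith))).mul
      ((hy.deriv.hd z).pow 2)
    refine HasDerivAt.congr_deriv (f := fun z => z ^ (N' / 2) * deriv y z ^ 2) h1 ?_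
    rw [rpow_w hN' hz.1]
    simp only [Pi.pow_apply]
    push_cast
    ring
  have i0 : IntervalIntegrable (fun z => (deriv y z ^ 2 * z ^ (N' / 2 - 1))) volume 0 1 :=
    Continuous.intervalIntegrable (by fun_prop) _ _
  have i1 : IntervalIntegrable (fun z => N' / 2 * (deriv y z ^ 2 * z ^ (N' / 2 - 1))
        + 2 * (z * deriv y z * deriv (deriv y) z * z ^ (N' / 2 - 1))) volume 0 1 :=
    Continuous.intervalIntegrable (by fun_prop) _ _
  have i2 : IntervalIntegrable (fun z => (z * deriv (deriv y) z) ^ 2 * z ^ (N' / 2 - 1)) volume 0 1 :=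
    Continuous.intervalIntegrable (by fun_prop) _ _
  have hI := intervalIntegral.integral_eq_sub_of_hasDerivAt hF i1
  have hN2 : N' / 2 ≠ 0 := by linarith
  rw [Real.zero_rpow hN2, Real.one_rpow] at hI
  have e : (fun z => (Del N y z) ^ 2 * z ^ (N' / 2 - 1)) = fun z =>
      ((z * deriv (deriv y) z) ^ 2 * z ^ (N' / 2 - 1)
      + (N / 2) * (N' / 2 * (deriv y z ^ 2 * z ^ (N' / 2 - 1))
        + 2 * (z * deriv y z * deriv (deriv y) z * z ^ (N' / 2 - 1))))
      + (N / 2 * (N / 2 - N' / 2)) * (deriv y z ^ 2 * z ^ (N' / 2 - 1)) := by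
    funext z; simp only [Del]; ring
  rw [X_sq, X_sq, e, intervalIntegral.integral_add (i2.add (i1.const_mul _)) (i0.const_mul _),
    intervalIntegral.integral_add i2 (i1.const_mul _), intervalIntegral.integral_const_mul,
    intervalIntegral.integral_const_mul, hI, ← X_sq N' (deriv y)]
  have p1 : 0 ≤ N / 2 * (1 * deriv y 1 ^ 2 - 0 * deriv y 0 ^ 2) := by
    have : 0 ≤ N / 2 := by linarith
    have := mul_nonneg this (sq_nonneg (deriv y 1))
    linarith
  have p2 : 0 ≤ N / 2 * (N / 2 - N' / 2) * Xnorm N' (deriv y) ^ 2 := by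
    apply mul_nonneg (mul_nonneg _ _) (sq_nonneg _) <;> linarith
  linarith

lemma X_smul {N : ℝ} (c : ℝ) (f : ℝ → ℝ) : Xnorm N (fun z => c * f z) = |c| * Xnorm N f := by
  unfold Xnorm
  rw [← Real.sqrt_sq_eq_abs, ← Real.sqrt_mul (sq_nonneg c), ← intervalIntegral.integral_const_mul]
  congr 2; funext z; ring

lemma hardy {N' N : ℝ} (hN' : 2 ≤ N') (hN : N' ≤ N) (h4 : 4 ≤ N) {y : ℝ → ℝ} (hy : Sm y) :
    Xnorm N' (deriv y) ≤ Xnorm N' (Del N y) := by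
  have h1 := hardy_aux hN' hN hy
  have h2 : Xnorm N' (fun z => (N / 2) * deriv y z)
      ≤ Xnorm N' (Del N y) + Xnorm N' (fun z => (-1) * (z * deriv (deriv y) z)) := by
    have : (fun z => (N / 2) * deriv y z)
        = fun z => Del N y z + (-1) * (z * deriv (deriv y) z) := by
      funext z; simp only [Del]; ring
    rw [this]
    have c2 := hy.deriv.deriv.cont
    exact X_add hN' (hy.del N).cont (by fun_prop)
  rw [X_smul, X_smul, abs_neg, abs_one, one_mul, abs_of_nonneg (by linarith)] at h2
  nlinarith [X_nonneg N' (deriv y)]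

/-! ### Commutation of `∂` and `Δ` -/

lemma deriv_Del (N : ℝ) {y : ℝ → ℝ} (hy : Sm y) : deriv (Del N y) = Del (N + 2) (deriv y) := by
  funext z
  have h := (((hasDerivAt_id z).mul (hy.deriv.deriv.hd z)).add ((hy.deriv.hd z).const_mul (N / 2)))
  have h2 : deriv (Del N y) z = _ := h.deriv
  rw [h2]; simp only [Del, id]; ring

lemma iter_Del (N : ℝ) (c : ℕ) {y : ℝ → ℝ} (hy : Sm y) :
    deriv^[c] (Del N y) = Del (N + 2 * c) (deriv^[c] y) := by
  induction c with
  | zero => simp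
  | succ k ih =>
    rw [Function.iterate_succ_apply', ih, deriv_Del _ (hy.iter k), Function.iterate_succ_apply']
    push_cast; congr 1; ring

lemma iter_bound {N : ℝ} (hN : 4 ≤ N) : ∀ (s c a : ℕ), c ≤ s → a ≤ c → ∀ y : ℝ → ℝ, Sm y →
    Xnorm (N + 2 * a) (deriv^[c] y) ≤ gnorm N (2 * c - a) y := by
  intro s
  induction s with
  | zero =>
    intro c a hc ha y hy
    obtain rfl : c = 0 := by omega
    obtain rfl : a = 0 := by omega
    simp [gnorm_eq, DD, DelIter]
  | succ s ih =>
    intro c a hc ha y hy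
    rcases Nat.lt_or_ge a c with h | h
    · obtain ⟨k, rfl⟩ : ∃ k, c = k + 1 := ⟨c - 1, by omega⟩
      have e : 2 * (k + 1) - a = (2 * k - a) + 2 := by omega
      rw [e, gnorm_add_two]
      refine le_trans ?_ (ih k a (by omega) (by omega) _ (hy.del N))
      rw [iter_Del _ _ hy, Function.iterate_succ_apply']
      have hak : (a : ℝ) ≤ k := by exact_mod_cast (by omega : a ≤ k)
      have ha0 : (0:ℝ) ≤ a := Nat.cast_nonneg a
      exact hardy (by linarith) (by linarith) (by linarith) (hy.iter k)
    · obtain rfl : a = c := by omega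
      have e : 2 * a - a = a := by omega
      rw [e]
      rcases a with _ | _ | k
      · simp [gnorm_eq, DD, DelIter]
      · rw [← X_shift]
        simp only [gnorm_eq, DD, DelIter, zero_add, Function.iterate_one, pow_one]
        exact le_rfl
      · rw [gnorm_add_two]
        have := ih k k (by omega) le_rfl _ (hy.del N)
        rw [show 2 * k - k = k by omega, iter_Del _ _ hy] at this
        refine le_trans ?_ this
        have h1 : N + 2 * ((k + 1 + 1 : ℕ) : ℝ) = (N + 2 * k) + 2 * (2 : ℕ) := by push_cast; ring
        rw [h1, ← X_shift]
        rw [Function.iterate_succ_apply', Function.iterate_succ_apply']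
        have h0 : (0:ℝ) ≤ k := Nat.cast_nonneg k
        refine le_trans (le_of_eq ?_) (hardy_aux (by linarith) le_rfl (hy.iter k))
        apply X_congr
        intro z hz
        rw [Real.sq_sqrt hz.1.le]


/-! ### Sup norm estimates for the coefficients -/

lemma sup_hardy_one {N K : ℝ} {a : ℕ} (hN : (a : ℝ) + 1 ≤ N) {y : ℝ → ℝ} (hy : Sm y)
    (h : ∀ z ∈ Ioc (0:ℝ) 1, Real.sqrt z ^ a * Del N y z ≤ K) :
    ∀ z ∈ Ioc (0:ℝ) 1, Real.sqrt z ^ a * deriv y z ≤ K / ((N - a) / 2) := by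
  set p := (N - a) / 2 with hp
  have ha0 : (0:ℝ) ≤ a := Nat.cast_nonneg a
  have hp0 : 0 < p := by rw [hp]; linarith
  have hN0 : 0 < N / 2 := by linarith
  have hsq : ∀ z : ℝ, 0 < z → z ^ (N / 2) = z ^ p * Real.sqrt z ^ a := by
    intro z hz
    rw [Real.sqrt_eq_rpow, ← Real.rpow_natCast, ← Real.rpow_mul hz.le, ← Real.rpow_add hz]
    congr 1; rw [hp]; ring
  let φ : ℝ → ℝ := fun z => K / p * z ^ p - z ^ (N / 2) * deriv y z
  have c1 := hy.deriv.cont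
  have hcont : Continuous φ := by
    have e1 := Real.continuous_rpow_const hp0.le
    have e2 := Real.continuous_rpow_const hN0.le
    exact (continuous_const.mul e1).sub (e2.mul c1)
  have hder : ∀ z : ℝ, 0 < z → HasDerivAt φ (z ^ (p - 1) * (K - Real.sqrt z ^ a * Del N y z)) z := by
    intro z hz
    have h1 := (Real.hasDerivAt_rpow_const (x := z) (p := p) (Or.inl hz.ne')).const_mul (K / p)
    have h2 := (Real.hasDerivAt_rpow_const (x := z) (p := N / 2) (Or.inl hz.ne')).mul (hy.deriv.hd z)
    refine HasDerivAt.congr_deriv (f := φ) (h1.sub h2) ?_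
    have e3 : z ^ (N / 2 - 1) = z ^ (p - 1) * Real.sqrt z ^ a := by
      rw [Real.rpow_sub hz, Real.rpow_sub hz, hsq z hz]; field_simp
    have e4 : z ^ (N / 2) = z * z ^ (p - 1) * Real.sqrt z ^ a := by
      rw [hsq z hz, Real.rpow_sub hz, Real.rpow_one]; field_simp
    rw [e3, e4]
    simp only [Del]
    field_simp
    ring
  have hmono : MonotoneOn φ (Icc 0 1) := by
    apply monotoneOn_of_deriv_nonneg (convex_Icc 0 1) hcont.continuousOn
    · intro z hz
      rw [interior_Icc] at hz
      exact (hder z hz.1).differentiableAt.differentiableWithinAt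
    · intro z hz
      rw [interior_Icc] at hz
      rw [(hder z hz.1).deriv]
      exact mul_nonneg (Real.rpow_nonneg hz.1.le _) (sub_nonneg.2 (h z ⟨hz.1, hz.2.le⟩))
  intro z hz
  have h0 := hmono (left_mem_Icc.2 zero_le_one) ⟨hz.1.le, hz.2⟩ hz.1.le
  simp only [φ, Real.zero_rpow hp0.ne', Real.zero_rpow hN0.ne', hsq z hz.1] at h0
  have hzp := Real.rpow_pos_of_pos hz.1 p
  have : z ^ p * (Real.sqrt z ^ a * deriv y z) ≤ z ^ p * (K / p) := by linarith
  exact le_of_mul_le_mul_left this hzp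

lemma Del_neg (N : ℝ) {y : ℝ → ℝ} (hy : Sm y) (z : ℝ) :
    Del N (fun z => (-1) * y z) z = - Del N y z := by
  rw [Del_smul N _ hy]; ring

lemma sup_hardy {N K : ℝ} {a : ℕ} (hN : (a : ℝ) + 1 ≤ N) (hK : 0 ≤ K) {y : ℝ → ℝ} (hy : Sm y)
    (h : ∀ z ∈ Ioc (0:ℝ) 1, Real.sqrt z ^ a * |Del N y z| ≤ K) :
    ∀ z ∈ Ioc (0:ℝ) 1, Real.sqrt z ^ a * |deriv y z| ≤ 2 * K := by
  intro z hz
  have hs : ∀ z : ℝ, 0 ≤ Real.sqrt z ^ a := fun z => pow_nonneg (Real.sqrt_nonneg z) a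
  have h1 := sup_hardy_one hN hy (K := K) (fun z hz =>
    (mul_le_mul_of_nonneg_left (le_abs_self _) (hs z)).trans (h z hz)) z hz
  have h2 := sup_hardy_one hN ((Sm.const (-1)).mul hy) (K := K) (fun z hz => by
    rw [Del_neg N hy]
    exact (mul_le_mul_of_nonneg_left (neg_le_abs _) (hs z)).trans (h z hz)) z hz
  rw [((hy.hd z).const_mul (-1)).deriv] at h2
  have h3 : K / ((N - a) / 2) ≤ 2 * K := by
    rw [div_le_iff₀ (by linarith)]
    nlinarith
  have h4 : Real.sqrt z ^ a * |deriv y z| = |Real.sqrt z ^ a * deriv y z| := by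
    rw [abs_mul, abs_of_nonneg (hs z)]
  rw [h4]
  apply abs_le.2
  constructor <;> nlinarith

lemma sup_bound : ∀ (s c a : ℕ), c ≤ s → a ≤ c → ∃ C > (0:ℝ), ∀ y : ℝ → ℝ, Sm y → ∀ K : ℝ, 0 ≤ K →
    (∀ z ∈ Ioc (0:ℝ) 1, |DD 1 (2 * c - a) y z| ≤ K) →
    ∀ z ∈ Ioc (0:ℝ) 1, Real.sqrt z ^ a * |deriv^[c] y z| ≤ C * K := by
  intro s
  induction s with
  | zero =>
    intro c a hc ha
    obtain rfl : c = 0 := by omega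
    obtain rfl : a = 0 := by omega
    refine ⟨1, one_pos, fun y hy K hK h z hz => ?_⟩
    simpa [DD, DelIter] using h z hz
  | succ s ih =>
    intro c a hc ha
    rcases Nat.lt_or_ge a c with h | h
    · obtain ⟨k, rfl⟩ : ∃ k, c = k + 1 := ⟨c - 1, by omega⟩
      have e : 2 * (k + 1) - a = (2 * k - a) + 2 := by omega
      obtain ⟨C, hC, hC2⟩ := ih k a (by omega) (by omega)
      refine ⟨2 * C, by positivity, fun y hy K hK h z hz => ?_⟩
      rw [e, DD_add_two] at h
      have h1 := hC2 _ (hy.del 1) K hK h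
      rw [iter_Del _ _ hy] at h1
      have hak : (a : ℝ) ≤ k := by exact_mod_cast (by omega : a ≤ k)
      have ha0 : (0:ℝ) ≤ a := Nat.cast_nonneg a
      have h2 := sup_hardy (by linarith) (by positivity) (hy.iter k) h1 z hz
      rw [Function.iterate_succ_apply']
      linarith
    · obtain rfl : a = c := by omega
      have e : 2 * a - a = a := by omega
      rcases a with _ | _ | k
      · refine ⟨1, one_pos, fun y hy K hK h z hz => ?_⟩
        simpa [DD, DelIter] using h z hz
      · refine ⟨1, one_pos, fun y hy K hK h z hz => ?_⟩
        have := h z hz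
        simp only [DD, DelIter, zero_add, Function.iterate_one, pow_one, one_mul] at this ⊢
        change |Real.sqrt z * deriv y z| ≤ K at this
        rwa [abs_mul, abs_of_nonneg (Real.sqrt_nonneg z)] at this
      · obtain ⟨C, hC, hC2⟩ := ih k k (by omega) le_rfl
        refine ⟨(1 + (1 + 2 * k)) * C, by positivity, fun y hy K hK h z hz => ?_⟩
        rw [e, DD_add_two] at h
        rw [show 2 * k - k = k by omega] at hC2
        have h1 := hC2 _ (hy.del 1) K hK h
        rw [iter_Del _ _ hy] at h1
        have h2 := sup_hardy (by linarith [Nat.cast_nonneg (α := ℝ) k]) (by positivity)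
          (hy.iter k) h1 z hz
        have h3 := h1 z hz
        rw [Function.iterate_succ_apply', Function.iterate_succ_apply']
        have hk : (0:ℝ) ≤ k := Nat.cast_nonneg k
        set u := deriv^[k] y
        have e1 : Real.sqrt z ^ (k + 1 + 1) = Real.sqrt z ^ k * z := by
          rw [add_assoc, pow_add, Real.sq_sqrt hz.1.le]
        have e2 : z * deriv (deriv u) z = Del (1 + 2 * k) u z - (1 + 2 * k) / 2 * deriv u z := by
          simp only [Del]; ring
        have e3 : z * |deriv (deriv u) z|
            ≤ |Del (1 + 2 * k) u z| + (1 + 2 * k) / 2 * |deriv u z| := by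
          have : z * |deriv (deriv u) z| = |z * deriv (deriv u) z| := by
            rw [abs_mul, abs_of_pos hz.1]
          rw [this, e2]
          refine (abs_sub _ _).trans ?_
          rw [abs_mul, abs_of_nonneg (by positivity : (0:ℝ) ≤ (1 + 2 * k) / 2)]
        have e4 : 0 ≤ Real.sqrt z ^ k := pow_nonneg (Real.sqrt_nonneg z) k
        rw [e1, mul_assoc]
        have e5 := mul_le_mul_of_nonneg_left e3 e4
        have e6 : (1 + 2 * (k:ℝ)) / 2 * (Real.sqrt z ^ k * |deriv u z|)
          ≤ (1 + 2 * k) / 2 * (2 * (C * K)) := mul_le_mul_of_nonneg_left h2 (by positivity)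
        nlinarith

lemma Ddot_Ddot {u : ℝ → ℝ} (hu : Sm u) {z : ℝ} (hz : 0 < z) : Ddot (Ddot u) z = Del 1 u z := by
  have h := (Real.hasDerivAt_sqrt hz.ne').mul (hu.deriv.hd z)
  have h2 : deriv (Ddot u) z = _ := h.deriv
  unfold Ddot at h2 ⊢
  rw [h2]
  simp only [Del]
  have := Real.sqrt_pos.2 hz
  have h3 := Real.mul_self_sqrt hz.le
  field_simp
  rw [Real.sq_sqrt hz.le]; ring

lemma Ddot_DD (k : ℕ) {u : ℝ → ℝ} (hu : Sm u) {z : ℝ} (hz : 0 < z) :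
    Ddot (DD 1 k u) z = DD 1 (k + 1) u z := by
  rcases Nat.even_or_odd' k with ⟨m, rfl | rfl⟩
  · rw [DD_even, DD_odd]
  · rw [DD_odd, show 2 * m + 1 + 1 = 2 * (m + 1) by ring, DD_even, Ddot_Ddot (hu.delIter 1 m) hz]
    rfl

lemma DD_diff (N : ℝ) (k : ℕ) {u : ℝ → ℝ} (hu : Sm u) {z : ℝ} (hz : 0 < z) :
    DifferentiableAt ℝ (DD N k u) z := by
  unfold DD
  split_ifs
  · exact (hu.delIter _ _).diff z
  · exact (Real.hasDerivAt_sqrt hz.ne').differentiableAt.mul ((hu.delIter _ _).deriv.diff z)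

lemma Ddot_iter (k : ℕ) {u : ℝ → ℝ} (hu : Sm u) : ∀ z : ℝ, 0 < z → Ddot^[k] u z = DD 1 k u z := by
  induction k with
  | zero => intro z hz; simp [DD, DelIter]
  | succ k ih =>
    intro z hz
    rw [Function.iterate_succ_apply', ← Ddot_DD k hu hz]
    simp only [Ddot]
    congr 1
    apply Filter.EventuallyEq.deriv_eq
    filter_upwards [Ioi_mem_nhds hz] with x hx
    exact ih x hx

lemma supN_bdd (k : ℕ) {u : ℝ → ℝ} (hu : Sm u) :
    BddAbove (range fun z : Icc (0:ℝ) 1 => |Ddot^[k] u z.1|) := by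
  obtain ⟨C, hC⟩ := (isCompact_Icc (a := (0:ℝ)) (b := 1)).exists_bound_of_continuousOn
    (DD_cont 1 k hu).continuousOn
  refine ⟨max C (max |u 0| 0), ?_⟩
  rintro _ ⟨⟨z, hz⟩, rfl⟩
  simp only
  rcases hz.1.lt_or_eq with h | h
  · rw [Ddot_iter k hu z h]
    exact (hC z hz).trans (le_max_left _ _)
  · subst h
    refine le_trans ?_ (le_max_right _ _)
    rcases k with _ | k
    · exact le_max_left _ _
    · rw [Function.iterate_succ_apply']
      simp [Ddot]

lemma supN_nonneg (f : ℝ → ℝ) : 0 ≤ supN f := Real.iSup_nonneg fun _ => abs_nonneg _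

lemma le_supN (k : ℕ) {u : ℝ → ℝ} (hu : Sm u) {z : ℝ} (hz : z ∈ Icc (0:ℝ) 1) :
    |Ddot^[k] u z| ≤ supN (Ddot^[k] u) :=
  le_ciSup (supN_bdd k hu) (⟨z, hz⟩ : Icc (0:ℝ) 1)

lemma DD_le_supN (k : ℕ) {u : ℝ → ℝ} (hu : Sm u) {z : ℝ} (hz : z ∈ Ioc (0:ℝ) 1) :
    |DD 1 k u z| ≤ supN (Ddot^[k] u) := by
  rw [← Ddot_iter k hu z hz.1]
  exact le_supN k hu ⟨hz.1.le, hz.2⟩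

lemma landau {f0 f1 f2 : ℝ → ℝ} {A B δ : ℝ} (h1 : ∀ r, 0 < r → HasDerivAt f0 (f1 r) r)
    (h2 : ∀ r, 0 < r → HasDerivAt f1 (f2 r) r) (hA : ∀ r ∈ Ioc (0:ℝ) 2, |f0 r| ≤ A)
    (hB : ∀ r ∈ Ioc (0:ℝ) 2, |f2 r| ≤ B) (hδ : 0 < δ) (hδ1 : δ ≤ 1) :
    ∀ r ∈ Ioc (0:ℝ) 2, |f1 r| ≤ 2 / δ * A + δ * B := by
  have main : ∀ c d : ℝ, 0 < c → d ≤ 2 → d = c + δ → ∀ r ∈ Icc c d, |f1 r| ≤ 2 / δ * A + δ * B := by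
    intro c d hc hd hcd r hr
    have hlt : c < d := by linarith
    obtain ⟨ξ, hξ, hξ2⟩ := exists_hasDerivAt_eq_slope f0 f1 hlt
      (fun x hx => (h1 x (by linarith [hx.1])).continuousAt.continuousWithinAt)
      (fun x hx => h1 x (by linarith [hx.1]))
    have e1 : |f1 ξ| ≤ 2 / δ * A := by
      rw [hξ2, abs_div, show d - c = δ by linarith, abs_of_pos hδ, div_le_iff₀ hδ]
      have := abs_sub (f0 d) (f0 c)
      have a1 := hA d ⟨by linarith, hd⟩
      have a2 := hA c ⟨hc, by linarith⟩
      have : 2 / δ * A * δ = 2 * A := by field_simp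
      linarith
    have e2 : |f1 r - f1 ξ| ≤ B * |r - ξ| := by
      have := (convex_Icc c d).norm_image_sub_le_of_norm_hasDerivWithin_le (f := f1) (f' := f2)
        (C := B) (x := ξ) (y := r)
        (fun x hx => (h2 x (by linarith [hx.1])).hasDerivWithinAt)
        (fun x hx => hB x ⟨by linarith [hx.1], by linarith [hx.2]⟩) ⟨hξ.1.le, hξ.2.le⟩ hr
      simpa using this
    have hB0 : 0 ≤ B := (abs_nonneg _).trans (hB c ⟨hc, by linarith⟩)
    have e3 : |r - ξ| ≤ δ := by
      rw [abs_le]; constructor <;> linarith [hr.1, hr.2, hξ.1, hξ.2]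
    have e4 := mul_le_mul_of_nonneg_left e3 hB0
    have e5 : |f1 r| ≤ |f1 ξ| + |f1 r - f1 ξ| := by
      have := abs_add_le (f1 ξ) (f1 r - f1 ξ)
      simpa using this
    linarith
  intro r hr
  rcases le_or_gt r 1 with h | h
  · exact main r (r + δ) hr.1 (by linarith) rfl r ⟨le_rfl, by linarith⟩
  · exact main (r - δ) r (by linarith) hr.2 (by ring) r ⟨by linarith, le_rfl⟩

lemma sup_interp (k : ℕ) {u : ℝ → ℝ} (hu : Sm u) {δ : ℝ} (hδ : 0 < δ) (hδ1 : δ ≤ 1) :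
    supN (Ddot^[k + 1] u) ≤ 2 / δ * supN (Ddot^[k] u) + δ * supN (Ddot^[k + 2] u) := by
  have hd : ∀ k : ℕ, ∀ r : ℝ, 0 < r → HasDerivAt (fun r => DD 1 k u (r ^ 2 / 4))
      (DD 1 (k + 1) u (r ^ 2 / 4)) r := by
    intro k r hr
    have hz : 0 < r ^ 2 / 4 := by positivity
    have h1 : HasDerivAt (fun r : ℝ => r ^ 2 / 4) (r / 2) r := by
      refine ((hasDerivAt_pow 2 r).div_const 4).congr_deriv ?_
      norm_num; ring
    have h2 := (DD_diff 1 k hu hz).hasDerivAt.comp r h1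
    refine h2.congr_deriv ?_
    rw [← Ddot_DD k hu hz]
    simp only [Ddot]
    have : Real.sqrt (r ^ 2 / 4) = r / 2 := by
      rw [show r ^ 2 / 4 = (r / 2) ^ 2 by ring, Real.sqrt_sq (by positivity)]
    rw [this]; ring
  have hmem : ∀ r ∈ Ioc (0:ℝ) 2, r ^ 2 / 4 ∈ Ioc (0:ℝ) 1 := by
    intro r hr
    have := hr.1
    refine ⟨by positivity, by nlinarith [hr.2]⟩
  have hL := landau (hd k) (hd (k + 1)) (fun r hr => DD_le_supN k hu (hmem r hr))
    (fun r hr => DD_le_supN (k + 2) hu (hmem r hr)) hδ hδ1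
  have : Nonempty (Icc (0:ℝ) 1) := ⟨⟨0, by simp⟩⟩
  apply ciSup_le
  rintro ⟨z, hz⟩
  simp only
  rcases hz.1.lt_or_eq with h | h
  · rw [Ddot_iter _ hu z h]
    have hs := Real.sqrt_pos.2 h
    have := hL (2 * Real.sqrt z) ⟨by positivity, by
      have := Real.sqrt_le_one.2 hz.2
      linarith⟩
    have e : (2 * Real.sqrt z) ^ 2 / 4 = z := by
      rw [mul_pow, Real.sq_sqrt h.le]; ring
    rwa [e] at this
  · subst h
    rw [Function.iterate_succ_apply']
    have a1 := supN_nonneg (Ddot^[k] u)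
    have a2 := supN_nonneg (Ddot^[k + 2] u)
    simp only [Ddot, Real.sqrt_zero, zero_mul, abs_zero]
    positivity

/-! ### Abstract interpolation -/

lemma abs_interp (K : ℕ) (D : ℝ) (hD : 0 < D) (η : ℝ) (hη : 0 < η) :
    ∃ C > (0:ℝ), ∀ a : ℕ → ℝ, (∀ k, 0 ≤ a k) →
      (∀ k < K, ∀ δ : ℝ, 0 < δ → δ ≤ 1 → a (k + 1) ≤ D / δ * a k + δ * a (k + 2)) →
      ∀ k ≤ K, a k ≤ η * a (K + 1) + C * a 0 := by
  have step : ∀ k : ℕ, ∀ η > (0:ℝ), ∃ C > (0:ℝ), ∀ a : ℕ → ℝ, (∀ k, 0 ≤ a k) →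
      (∀ k < K, ∀ δ : ℝ, 0 < δ → δ ≤ 1 → a (k + 1) ≤ D / δ * a k + δ * a (k + 2)) →
      k ≤ K → a k ≤ η * a (k + 1) + C * a 0 := by
    intro k
    induction k with
    | zero =>
      intro η hη
      refine ⟨1, one_pos, fun a ha _ _ => ?_⟩
      have := mul_nonneg hη.le (ha 1)
      simp only [zero_add]
      linarith
    | succ k ih =>
      intro η hη
      set δ := min (η / 2) 1 with hδ
      have hδ0 : 0 < δ := lt_min (by positivity) one_pos
      have hδ1 : δ ≤ 1 := min_le_right _ _
      have hδ2 : δ ≤ η / 2 := min_le_left _ _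
      obtain ⟨C, hC, hC2⟩ := ih (δ / (2 * D)) (by positivity)
      refine ⟨2 * (D / δ * C), by positivity, fun a ha h hk => ?_⟩
      have h1 := h k (by omega) δ hδ0 hδ1
      have h2 := hC2 a ha h (by omega)
      have h3 : D / δ * a k ≤ D / δ * (δ / (2 * D) * a (k + 1) + C * a 0) :=
        mul_le_mul_of_nonneg_left h2 (by positivity)
      have h4 : D / δ * (δ / (2 * D) * a (k + 1) + C * a 0)
          = 1 / 2 * a (k + 1) + D / δ * C * a 0 := by
        field_simp
      have h5 := mul_le_mul_of_nonneg_right hδ2 (ha (k + 2))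
      show a (k + 1) ≤ η * a (k + 2) + _
      linarith
  have step2 : ∀ d : ℕ, ∀ η > (0:ℝ), ∃ C > (0:ℝ), ∀ a : ℕ → ℝ, (∀ k, 0 ≤ a k) →
      (∀ k < K, ∀ δ : ℝ, 0 < δ → δ ≤ 1 → a (k + 1) ≤ D / δ * a k + δ * a (k + 2)) →
      ∀ k, k + d = K → a k ≤ η * a (K + 1) + C * a 0 := by
    intro d
    induction d with
    | zero =>
      intro η hη
      obtain ⟨C, hC, h⟩ := step K η hη
      refine ⟨C, hC, fun a ha h1 k hk => ?_⟩
      obtain rfl : k = K := by omega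
      exact h a ha h1 le_rfl
    | succ d ih =>
      intro η hη
      obtain ⟨C, hC, h⟩ := ih η hη
      rcases Nat.lt_or_ge K d with hd | hd
      · refine ⟨1, one_pos, fun a ha h1 k hk => by omega⟩
      obtain ⟨C', hC', h'⟩ := step (K - (d + 1)) 1 one_pos
      refine ⟨C + C', by positivity, fun a ha h1 k hk => ?_⟩
      have e1 := h' a ha h1 (by omega)
      have e2 := h a ha h1 (k + 1) (by omega)
      rw [show K - (d + 1) = k by omega] at e1
      linarith
  choose! C hC hC2 using step2
  refine ⟨1 + ∑ d ∈ Finset.range (K + 1), C d η, ?_, ?_⟩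
  · have : 0 ≤ ∑ d ∈ Finset.range (K + 1), C d η :=
      Finset.sum_nonneg fun d _ => (hC d η hη).le
    linarith
  · intro a ha h k hk
    have h1 := hC2 (K - k) η hη a ha h k (by omega)
    have h2 : C (K - k) η ≤ ∑ d ∈ Finset.range (K + 1), C d η :=
      Finset.single_le_sum (f := fun d => C d η) (fun d _ => (hC d η hη).le)
        (Finset.mem_range.2 (by omega))
    have h3 := mul_le_mul_of_nonneg_right h2 (ha 0)
    have h4 := ha 0
    linarith


/-! ### Traces and interpolation in the graded norms -/

lemma trace_zero {N : ℝ} (hN : 2 ≤ N) {y : ℝ → ℝ} (hy : Sm y) :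
    y 1 ^ 2 ≤ N / 2 * Xnorm N y ^ 2 + 2 * (Xnorm N y * Xnorm N (Ddot y)) := by
  have hw := wcont hN
  have c0 := hy.cont
  have c1 := hy.deriv.cont
  have cd := hy.ddot
  have cs : Continuous (fun z => Real.sqrt z * y z) := Real.continuous_sqrt.mul c0
  have hF : ∀ z ∈ uIcc (0:ℝ) 1, HasDerivAt (fun z => z ^ (N / 2) * y z ^ 2)
      (N / 2 * (y z ^ 2 * z ^ (N / 2 - 1))
        + 2 * ((Real.sqrt z * y z) * Ddot y z * z ^ (N / 2 - 1))) z := by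
    intro z hz
    rw [uIcc_of_le (by norm_num)] at hz
    have h1 := (Real.hasDerivAt_rpow_const (x := z) (p := N / 2) (Or.inr (by linarith))).mul
      ((hy.hd z).pow 2)
    refine HasDerivAt.congr_deriv (f := fun z => z ^ (N / 2) * y z ^ 2) h1 ?_
    rw [rpow_w hN hz.1]
    simp only [Pi.pow_apply, Ddot]
    have : Real.sqrt z * y z * (Real.sqrt z * deriv y z) = z * (y z * deriv y z) := by
      rw [mul_mul_mul_comm, Real.mul_self_sqrt hz.1]
    rw [this]
    push_cast
    ring
  have i0 : IntervalIntegrable (fun z => N / 2 * (y z ^ 2 * z ^ (N / 2 - 1))) volume 0 1 :=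
    Continuous.intervalIntegrable (by fun_prop) _ _
  have i1 : IntervalIntegrable (fun z => 2 * ((Real.sqrt z * y z) * Ddot y z * z ^ (N / 2 - 1)))
      volume 0 1 := Continuous.intervalIntegrable (by fun_prop) _ _
  have hI := intervalIntegral.integral_eq_sub_of_hasDerivAt hF (i0.add i1)
  rw [intervalIntegral.integral_add i0 i1, intervalIntegral.integral_const_mul,
    intervalIntegral.integral_const_mul, ← X_sq, Real.zero_rpow (by linarith), Real.one_rpow] at hI
  have h1 := (abs_le.1 (X_cs hN cs cd)).2
  have h2 : Xnorm N (fun z => Real.sqrt z * y z) ≤ 1 * Xnorm N y := by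
    apply X_mono hN cs c0 zero_le_one
    intro z hz
    rw [abs_mul, abs_of_nonneg (Real.sqrt_nonneg z)]
    exact mul_le_mul_of_nonneg_right (Real.sqrt_le_one.2 hz.2.le) (abs_nonneg _)
  have h3 := mul_le_mul_of_nonneg_right h2 (X_nonneg N (Ddot y))
  linarith

lemma trace_one {N : ℝ} (hN : 2 ≤ N) {y : ℝ → ℝ} (hy : Sm y) :
    deriv y 1 ^ 2 ≤ 2 * (Xnorm N (Ddot y) * Xnorm N (Del N y)) := by
  have hw := wcont hN
  have hw2 : Continuous (fun z : ℝ => z ^ (N / 2)) := Real.continuous_rpow_const (by linarith)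
  have c1 := hy.deriv.cont
  have cD := (hy.del N).cont
  have cs : Continuous (fun z => z ^ (N / 2) * deriv y z) := hw2.mul c1
  have hF : ∀ z ∈ uIcc (0:ℝ) 1, HasDerivAt (fun z => (z ^ (N / 2) * deriv y z) ^ 2)
      (2 * ((z ^ (N / 2) * deriv y z) * Del N y z * z ^ (N / 2 - 1))) z := by
    intro z hz
    rw [uIcc_of_le (by norm_num)] at hz
    have h1 := ((Real.hasDerivAt_rpow_const (x := z) (p := N / 2) (Or.inr (by linarith))).mul
      (hy.deriv.hd z)).pow 2
    refine HasDerivAt.congr_deriv (f := fun z => (z ^ (N / 2) * deriv y z) ^ 2) h1 ?_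
    simp only [Pi.mul_apply, Del]
    rw [rpow_w hN hz.1]
    push_cast
    ring
  have i1 : IntervalIntegrable (fun z => 2 * ((z ^ (N / 2) * deriv y z) * Del N y z * z ^ (N / 2 - 1)))
      volume 0 1 := Continuous.intervalIntegrable (by fun_prop) _ _
  have hI := intervalIntegral.integral_eq_sub_of_hasDerivAt hF i1
  rw [intervalIntegral.integral_const_mul, Real.zero_rpow (by linarith), Real.one_rpow] at hI
  have h1 := (abs_le.1 (X_cs hN cs cD)).2
  have h2 : Xnorm N (fun z => z ^ (N / 2) * deriv y z) ≤ 1 * Xnorm N (Ddot y) := by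
    apply X_mono hN cs hy.ddot zero_le_one
    intro z hz
    rw [Ddot, one_mul, abs_mul, abs_mul, abs_of_nonneg (Real.sqrt_nonneg z),
      abs_of_nonneg (Real.rpow_nonneg hz.1.le _)]
    apply mul_le_mul_of_nonneg_right _ (abs_nonneg _)
    rw [Real.sqrt_eq_rpow]
    exact Real.rpow_le_rpow_of_exponent_ge hz.1 hz.2.le (by linarith)
  have h3 := mul_le_mul_of_nonneg_right h2 (X_nonneg N (Del N y))
  linarith

lemma ibp {N : ℝ} (hN : 2 ≤ N) {y u : ℝ → ℝ} (hy : Sm y) (hu : Sm u) :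
    (∫ z in (0:ℝ)..1, Del N y z * u z * z ^ (N / 2 - 1))
      + (∫ z in (0:ℝ)..1, Ddot y z * Ddot u z * z ^ (N / 2 - 1)) = deriv y 1 * u 1 := by
  have hw := wcont hN
  have c0 := hu.cont
  have cd := hy.ddot
  have cd2 := hu.ddot
  have cD := (hy.del N).cont
  have hF : ∀ z ∈ uIcc (0:ℝ) 1, HasDerivAt (fun z => (z ^ (N / 2) * deriv y z) * u z)
      (Del N y z * u z * z ^ (N / 2 - 1) + Ddot y z * Ddot u z * z ^ (N / 2 - 1)) z := by
    intro z hz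
    rw [uIcc_of_le (by norm_num)] at hz
    have h1 := ((Real.hasDerivAt_rpow_const (x := z) (p := N / 2) (Or.inr (by linarith))).mul
      (hy.deriv.hd z)).mul (hu.hd z)
    refine HasDerivAt.congr_deriv (f := fun z => (z ^ (N / 2) * deriv y z) * u z) h1 ?_
    simp only [Pi.mul_apply, Del, Ddot]
    rw [rpow_w hN hz.1]
    have : Real.sqrt z * deriv y z * (Real.sqrt z * deriv u z) = z * (deriv y z * deriv u z) := by
      rw [mul_mul_mul_comm, Real.mul_self_sqrt hz.1]
    rw [this]
    ring
  have i0 : IntervalIntegrable (fun z => Del N y z * u z * z ^ (N / 2 - 1)) volume 0 1 :=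
    Continuous.intervalIntegrable (by fun_prop) _ _
  have i1 : IntervalIntegrable (fun z => Ddot y z * Ddot u z * z ^ (N / 2 - 1)) volume 0 1 :=
    Continuous.intervalIntegrable (by fun_prop) _ _
  have hI := intervalIntegral.integral_eq_sub_of_hasDerivAt hF (i0.add i1)
  rw [intervalIntegral.integral_add i0 i1, Real.zero_rpow (by linarith), Real.one_rpow] at hI
  linarith

lemma normN_nonneg (N : ℝ) (k : ℕ) (f : ℝ → ℝ) : 0 ≤ normN N k f := Real.sqrt_nonneg _

lemma normN_sq (N : ℝ) (k : ℕ) (f : ℝ → ℝ) :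
    normN N k f ^ 2 = ∑ ℓ ∈ Finset.range (k + 1), (gnorm N ℓ f) ^ 2 :=
  Real.sq_sqrt (Finset.sum_nonneg fun _ _ => sq_nonneg _)

lemma normN_sq_succ (N : ℝ) (k : ℕ) (f : ℝ → ℝ) :
    normN N (k + 1) f ^ 2 = normN N k f ^ 2 + gnorm N (k + 1) f ^ 2 := by
  rw [normN_sq, normN_sq, Finset.sum_range_succ]

lemma normN_mono (N : ℝ) {k l : ℕ} (h : k ≤ l) (f : ℝ → ℝ) : normN N k f ≤ normN N l f := by
  apply le_of_sq_le_sq _ (normN_nonneg _ _ _)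
  rw [normN_sq, normN_sq]
  apply Finset.sum_le_sum_of_subset_of_nonneg
  · intro x hx; simp only [Finset.mem_range] at hx ⊢; omega
  · intros; positivity

lemma gnorm_le_normN (N : ℝ) {k l : ℕ} (h : k ≤ l) (f : ℝ → ℝ) : gnorm N k f ≤ normN N l f := by
  apply le_of_sq_le_sq _ (normN_nonneg _ _ _)
  rw [normN_sq]
  exact Finset.single_le_sum (f := fun ℓ => gnorm N ℓ f ^ 2) (fun _ _ => sq_nonneg _)
    (Finset.mem_range.2 (by omega))

lemma interp_alg {N P Q R A B g r : ℝ} (hN : 2 ≤ N) (hP : 0 ≤ P) (hQ : 0 ≤ Q) (hR : 0 ≤ R)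
    (hPR : P ≤ R) (hQ2 : Q ^ 2 = P ^ 2 + g ^ 2) (hg : g ^ 2 = A * B - r) (hr : |r| ≤ P * R)
    (hAB : A ^ 2 * B ^ 2 ≤ (2 * (N / 2 + 2)) * (P * R * Q ^ 2)) :
    Q ^ 2 ≤ (N + 8) * (P * R) := by
  have hPR0 : 0 ≤ P * R := mul_nonneg hP hR
  have h1 : A * B ≤ 1 / 2 * Q ^ 2 + 1 / 2 * ((N + 4) * (P * R)) := by
    apply le_of_sq_le_sq
    · nlinarith [sq_nonneg (1 / 2 * Q ^ 2 - 1 / 2 * ((N + 4) * (P * R)))]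
    · have : 0 ≤ (N + 4) * (P * R) := mul_nonneg (by linarith) hPR0
      positivity
  have h2 : P ^ 2 ≤ P * R := by nlinarith
  have h3 := neg_abs_le r
  nlinarith

lemma interp_sq {N : ℝ} (hN : 2 ≤ N) (k : ℕ) {h : ℝ → ℝ} (hh : Sm h) :
    normN N (k + 1) h ^ 2 ≤ (N + 8) * (normN N k h * normN N (k + 2) h) := by
  have hP := normN_nonneg N k h
  have hQ := normN_nonneg N (k + 1) h
  have hR := normN_nonneg N (k + 2) h
  have hPQ := normN_mono N (Nat.le_succ k) h
  have hQR := normN_mono N (Nat.le_succ (k + 1)) h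
  have hPR := hPQ.trans hQR
  have g0 := gnorm_le_normN N (le_refl k) h
  have g1 := gnorm_le_normN N (le_refl (k + 1)) h
  have g2 := gnorm_le_normN N (le_refl (k + 2)) h
  have n0 := gnorm_nonneg N k h
  have n1 := gnorm_nonneg N (k + 1) h
  have n2 := gnorm_nonneg N (k + 2) h
  have hsq := normN_sq_succ N k h
  change normN N k h ≤ normN N (k + 1) h at hPQ
  change normN N (k + 1) h ≤ normN N (k + 2) h at hQR
  set P := normN N k h
  set Q := normN N (k + 1) h
  set R := normN N (k + 2) h
  rcases Nat.even_or_odd' k with ⟨m, rfl | rfl⟩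
  · set y := DelIter N m h with hy
    have sy : Sm y := hh.delIter N m
    have e0 : gnorm N (2 * m) h = Xnorm N y := by rw [gnorm_eq, DD_even]
    have e1 : gnorm N (2 * m + 1) h = Xnorm N (Ddot y) := by rw [gnorm_eq, DD_odd]
    have e2 : gnorm N (2 * m + 2) h = Xnorm N (Del N y) := by
      rw [gnorm_eq, show 2 * m + 2 = 2 * (m + 1) by ring, DD_even]; rfl
    have t0 := trace_zero hN sy
    have t1 := trace_one hN sy
    have hi := ibp hN sy sy
    have cs := X_cs hN (sy.del N).cont sy.cont
    have hd : (∫ z in (0:ℝ)..1, Ddot y z * Ddot y z * z ^ (N / 2 - 1)) = Xnorm N (Ddot y) ^ 2 := by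
      rw [X_sq]; congr 1; funext z; ring
    rw [hd] at hi
    rw [← e0, ← e1] at t0
    rw [← e1, ← e2] at t1
    rw [← e2, ← e0] at cs
    rw [← e1] at hi
    refine interp_alg (A := deriv y 1) (B := y 1) hN hP hQ hR hPR hsq
      (r := ∫ z in (0:ℝ)..1, Del N y z * y z * z ^ (N / 2 - 1)) (by linarith) ?_ ?_
    · refine cs.trans ?_
      rw [mul_comm]
      exact mul_le_mul g0 g2 n2 hP
    · have b1 : deriv y 1 ^ 2 ≤ 2 * (Q * R) := t1.trans (by gcongr)
      have b0 : y 1 ^ 2 ≤ (N / 2 + 2) * (P * Q) := by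
        refine t0.trans ?_
        have : N / 2 * gnorm N (2 * m) h ^ 2 ≤ N / 2 * (P * Q) := by
          apply mul_le_mul_of_nonneg_left _ (by linarith)
          rw [sq]; exact mul_le_mul g0 (g0.trans hPQ) n0 hP
        have : gnorm N (2 * m) h * gnorm N (2 * m + 1) h ≤ P * Q := by gcongr
        linarith
      refine (mul_le_mul b1 b0 (sq_nonneg _) (by positivity)).trans (le_of_eq ?_)
      ring
  · set y := DelIter N m h with hy
    have sy : Sm y := hh.delIter N m
    have su := sy.del N
    have e0 : gnorm N (2 * m + 1) h = Xnorm N (Ddot y) := by rw [gnorm_eq, DD_odd]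
    have e1 : gnorm N (2 * m + 1 + 1) h = Xnorm N (Del N y) := by
      rw [gnorm_eq, show 2 * m + 1 + 1 = 2 * (m + 1) by ring, DD_even]; rfl
    have e2 : gnorm N (2 * m + 1 + 2) h = Xnorm N (Ddot (Del N y)) := by
      rw [gnorm_eq, show 2 * m + 1 + 2 = 2 * (m + 1) + 1 by ring, DD_odd]; rfl
    have t0 := trace_zero hN su
    have t1 := trace_one hN sy
    have hi := ibp hN sy su
    have cs := X_cs hN sy.ddot su.ddot
    have hd : (∫ z in (0:ℝ)..1, Del N y z * Del N y z * z ^ (N / 2 - 1)) = Xnorm N (Del N y) ^ 2 := by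
      rw [X_sq]; congr 1; funext z; ring
    rw [hd] at hi
    rw [← e1, ← e2] at t0
    rw [← e0, ← e1] at t1
    rw [← e0, ← e2] at cs
    rw [← e1] at hi
    refine interp_alg (A := deriv y 1) (B := Del N y 1) hN hP hQ hR hPR hsq
      (r := ∫ z in (0:ℝ)..1, Ddot y z * Ddot (Del N y) z * z ^ (N / 2 - 1)) (by linarith) ?_ ?_
    · exact cs.trans (mul_le_mul g0 g2 n2 hP)
    · have b1 : deriv y 1 ^ 2 ≤ 2 * (P * Q) := t1.trans (by gcongr)
      have b0 : Del N y 1 ^ 2 ≤ (N / 2 + 2) * (Q * R) := by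
        refine t0.trans ?_
        have : N / 2 * gnorm N (2 * m + 1 + 1) h ^ 2 ≤ N / 2 * (Q * R) := by
          apply mul_le_mul_of_nonneg_left _ (by linarith)
          rw [sq]; exact mul_le_mul g1 (g1.trans hQR) n1 hQ
        have : gnorm N (2 * m + 1 + 1) h * gnorm N (2 * m + 1 + 2) h ≤ Q * R := by gcongr
        linarith
      refine (mul_le_mul b1 b0 (sq_nonneg _) (by positivity)).trans (le_of_eq ?_)
      ring

lemma norm_interp {N : ℝ} (hN : 2 ≤ N) (k : ℕ) {h : ℝ → ℝ} (hh : Sm h) {δ : ℝ} (hδ : 0 < δ) :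
    normN N (k + 1) h ≤ (N + 8) / δ * normN N k h + δ * normN N (k + 2) h := by
  have h1 := interp_sq hN k hh
  have hP := normN_nonneg N k h
  have hR := normN_nonneg N (k + 2) h
  have hN8 : 0 ≤ N + 8 := by linarith
  apply le_of_sq_le_sq _ (by positivity)
  have e : (N + 8) / δ * normN N k h * (δ * normN N (k + 2) h)
      = (N + 8) * (normN N k h * normN N (k + 2) h) := by field_simp
  have : 0 ≤ (N + 8) * (normN N k h * normN N (k + 2) h) := by positivity
  nlinarith [sq_nonneg ((N + 8) / δ * normN N k h), sq_nonneg (δ * normN N (k + 2) h)]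

/-! ### The operator `z ∂_z` -/

lemma DelIter_Dch (N : ℝ) (m : ℕ) {h : ℝ → ℝ} (hh : Sm h) :
    DelIter N m (fun z => z * deriv h z)
      = fun z => z * deriv (DelIter N m h) z + m * DelIter N m h z := by
  induction m with
  | zero => funext z; simp [DelIter]
  | succ k ih =>
    funext z
    show Del N (DelIter N k _) z = _
    have su := hh.delIter N k
    rw [ih, Del_add N (Sm.id.mul su.deriv) ((Sm.const _).mul su), Del_smul N _ su,
      Del_mul N Sm.id su.deriv]
    have e1 : deriv (fun z : ℝ => z) = fun _ => 1 := by funext z; exact deriv_id z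
    have e2 : DelIter N (k + 1) h = Del N (DelIter N k h) := rfl
    rw [e2, deriv_Del N su]
    simp only [Del, e1, deriv_const']
    push_cast
    ring

lemma gnorm_Dch {N : ℝ} (hN : 2 ≤ N) (ℓ : ℕ) : ∃ C > (0:ℝ), ∀ h : ℝ → ℝ, Sm h →
    gnorm N ℓ (fun z => z * deriv h z) ≤ C * normN N (ℓ + 1) h := by
  rcases Nat.even_or_odd' ℓ with ⟨m, rfl | rfl⟩
  · refine ⟨1 + m, by positivity, fun h hh => ?_⟩
    have su := hh.delIter N m
    rw [gnorm_eq, DD_even, DelIter_Dch N m hh]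
    have c1 : Continuous (fun z => z * deriv (DelIter N m h) z) := (Sm.id.mul su.deriv).cont
    have c2 : Continuous (fun z => (m:ℝ) * DelIter N m h z) := ((Sm.const _).mul su).cont
    refine (X_add hN c1 c2).trans ?_
    rw [X_smul, abs_of_nonneg (Nat.cast_nonneg m)]
    have h1 : Xnorm N (fun z => z * deriv (DelIter N m h) z) ≤ 1 * Xnorm N (Ddot (DelIter N m h)) := by
      apply X_mono hN c1 su.ddot zero_le_one
      intro z hz
      rw [one_mul, Ddot, abs_mul, abs_mul, abs_of_nonneg (Real.sqrt_nonneg z), abs_of_pos hz.1]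
      apply mul_le_mul_of_nonneg_right _ (abs_nonneg _)
      have := Real.sqrt_le_one.2 hz.2.le
      have h0 := Real.sqrt_nonneg z
      nlinarith [Real.mul_self_sqrt hz.1.le]
    have h2 := gnorm_le_normN N (le_refl (2 * m + 1)) h
    have h3 := gnorm_le_normN N (Nat.le_succ (2 * m)) h
    rw [gnorm_eq, DD_odd] at h2
    rw [gnorm_eq, DD_even] at h3
    have h4 := mul_le_mul_of_nonneg_left h3 (Nat.cast_nonneg (α := ℝ) m)
    change _ ≤ (m:ℝ) * normN N (2 * m + 1) h at h4
    linarith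
  · refine ⟨1 + |1 + m - N / 2|, by positivity, fun h hh => ?_⟩
    have su := hh.delIter N m
    rw [gnorm_eq, DD_odd, DelIter_Dch N m hh]
    set u := DelIter N m h
    have e : Ddot (fun z => z * deriv u z + m * u z)
        = fun z => Real.sqrt z * Del N u z + (1 + m - N / 2) * Ddot u z := by
      funext z
      have := (((hasDerivAt_id z).mul (su.deriv.hd z)).add ((su.hd z).const_mul (m:ℝ)))
      have h2 : deriv (fun z => z * deriv u z + m * u z) z = _ := this.deriv
      simp only [Ddot]
      rw [h2]
      simp only [Del, id]; ring
    rw [e]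
    have c1 : Continuous (fun z => Real.sqrt z * Del N u z) :=
      Real.continuous_sqrt.mul (su.del N).cont
    have c2 : Continuous (fun z => (1 + m - N / 2) * Ddot u z) := continuous_const.mul su.ddot
    refine (X_add hN c1 c2).trans ?_
    rw [X_smul]
    have h1 : Xnorm N (fun z => Real.sqrt z * Del N u z) ≤ 1 * Xnorm N (Del N u) := by
      apply X_mono hN c1 (su.del N).cont zero_le_one
      intro z hz
      rw [abs_mul, abs_of_nonneg (Real.sqrt_nonneg z)]
      exact mul_le_mul_of_nonneg_right (Real.sqrt_le_one.2 hz.2.le) (abs_nonneg _)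
    have h2 := gnorm_le_normN N (le_refl (2 * m + 1 + 1)) h
    have h3 := gnorm_le_normN N (Nat.le_succ (2 * m + 1)) h
    rw [gnorm_eq, show 2 * m + 1 + 1 = 2 * (m + 1) by ring, DD_even] at h2
    change Xnorm N (Del N u) ≤ _ at h2
    rw [gnorm_eq, DD_odd] at h3
    change Xnorm N (Ddot u) ≤ normN N (2 * m + 1 + 1) h at h3
    have h4 := mul_le_mul_of_nonneg_left h3 (abs_nonneg (1 + m - N / 2))
    rw [show 2 * (m + 1) = 2 * m + 1 + 1 by ring] at h2
    linarith


/-! ### Commutators with multiplication -/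

/-- One bilinear term `κ √z^e ∂^j b ∂^k y`. -/
noncomputable def tmE (q : ℝ × ℕ × ℕ × ℕ) (b y : ℝ → ℝ) : ℝ → ℝ := fun z =>
  q.1 * (Real.sqrt z ^ q.2.1 * (deriv^[q.2.2.1] b z * deriv^[q.2.2.2] y z))

/-- One bilinear term `κ z^p ∂^j b ∂^k y`. -/
noncomputable def tm (q : ℝ × ℕ × ℕ × ℕ) (b y : ℝ → ℝ) : ℝ → ℝ := fun z =>
  q.1 * (z ^ q.2.1 * (deriv^[q.2.2.1] b z * deriv^[q.2.2.2] y z))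

noncomputable def evE (L : List (ℝ × ℕ × ℕ × ℕ)) (b y : ℝ → ℝ) : ℝ → ℝ := fun z =>
  (L.map fun q => tmE q b y z).sum

noncomputable def ev (L : List (ℝ × ℕ × ℕ × ℕ)) (b y : ℝ → ℝ) : ℝ → ℝ := fun z =>
  (L.map fun q => tm q b y z).sum

def okE (ℓ : ℕ) (q : ℝ × ℕ × ℕ × ℕ) : Prop :=
  1 ≤ q.2.2.1 ∧ q.2.1 ≤ q.2.2.1 + q.2.2.2 ∧ 2 * (q.2.2.1 + q.2.2.2) = q.2.1 + ℓ

def ok (m : ℕ) (q : ℝ × ℕ × ℕ × ℕ) : Prop :=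
  1 ≤ q.2.2.1 ∧ 2 * q.2.1 ≤ q.2.2.1 + q.2.2.2 ∧ q.2.2.1 + q.2.2.2 = q.2.1 + m

lemma Sm.tm (q : ℝ × ℕ × ℕ × ℕ) {b y : ℝ → ℝ} (hb : Sm b) (hy : Sm y) : Sm (tm q b y) :=
  (Sm.const _).mul ((Sm.pow _).mul ((hb.iter _).mul (hy.iter _)))

lemma Sm.ev (L : List (ℝ × ℕ × ℕ × ℕ)) {b y : ℝ → ℝ} (hb : Sm b) (hy : Sm y) : Sm (ev L b y) := by
  induction L with
  | nil => exact Sm.const 0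
  | cons q L ih => exact (Sm.tm q hb hy).add ih

lemma tmE_cont (q : ℝ × ℕ × ℕ × ℕ) {b y : ℝ → ℝ} (hb : Sm b) (hy : Sm y) :
    Continuous (tmE q b y) :=
  continuous_const.mul ((Real.continuous_sqrt.pow _).mul ((hb.iter _).cont.mul (hy.iter _).cont))

lemma evE_cont (L : List (ℝ × ℕ × ℕ × ℕ)) {b y : ℝ → ℝ} (hb : Sm b) (hy : Sm y) :
    Continuous (evE L b y) := by
  induction L with
  | nil => exact continuous_const
  | cons q L ih => exact (tmE_cont q hb hy).add ih

lemma Del_pow_zero (N : ℝ) (z : ℝ) : Del N (fun z : ℝ => z ^ 0) z = 0 := by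
  have : (fun z : ℝ => z ^ 0) = fun _ => 1 := by funext z; simp
  rw [this]; simp [Del]

lemma Del_pow_succ (N : ℝ) (p : ℕ) (z : ℝ) :
    Del N (fun z : ℝ => z ^ (p + 1)) z = ((p + 1) * p + N / 2 * (p + 1)) * z ^ p := by
  have e1 : deriv (fun z : ℝ => z ^ (p + 1)) = fun z => ((p:ℝ) + 1) * z ^ p := by
    funext z; rw [(hasDerivAt_pow (p + 1) z).deriv]; push_cast; simp
  have e2 : deriv (fun z : ℝ => ((p:ℝ) + 1) * z ^ p) z = (p + 1) * (p * z ^ (p - 1)) :=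
    ((hasDerivAt_pow p z).const_mul _).deriv
  simp only [Del, e1, e2]
  rcases p with _ | p
  · simp
  · simp only [Nat.add_sub_cancel]; push_cast; ring

lemma deriv_iter_mul (j k : ℕ) {b y : ℝ → ℝ} (hb : Sm b) (hy : Sm y) (z : ℝ) :
    deriv (fun z => deriv^[j] b z * deriv^[k] y z) z
      = deriv^[j + 1] b z * deriv^[k] y z + deriv^[j] b z * deriv^[k + 1] y z := by
  rw [Function.iterate_succ_apply', Function.iterate_succ_apply']
  exact (((hb.iter j).hd z).mul ((hy.iter k).hd z)).deriv

lemma Del_tm (N : ℝ) (m : ℕ) (q : ℝ × ℕ × ℕ × ℕ) (hq : ok m q) :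
    ∃ L : List (ℝ × ℕ × ℕ × ℕ), (∀ r ∈ L, ok (m + 1) r) ∧ ∀ b y : ℝ → ℝ, Sm b → Sm y →
      Del N (tm q b y) = ev L b y := by
  obtain ⟨κ, p, j, k⟩ := q
  simp only [ok] at hq
  obtain ⟨h1, h2, h3⟩ := hq
  have key : ∀ b y : ℝ → ℝ, Sm b → Sm y → ∀ z, Del N (tm (κ, p, j, k) b y) z
      = κ * (z ^ p * (deriv^[j] b z * Del N (deriv^[k] y) z
          + 2 * z * deriv^[j + 1] b z * deriv^[k + 1] y z + Del N (deriv^[j] b) z * deriv^[k] y z)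
        + 2 * z * deriv (fun z : ℝ => z ^ p) z *
          (deriv^[j + 1] b z * deriv^[k] y z + deriv^[j] b z * deriv^[k + 1] y z)
        + Del N (fun z : ℝ => z ^ p) z * (deriv^[j] b z * deriv^[k] y z)) := by
    intro b y hb hy z
    have s := (hb.iter j).mul (hy.iter k)
    have : tm (κ, p, j, k) b y
      = fun z => κ * (z ^ p * (deriv^[j] b z * deriv^[k] y z)) := rfl
    rw [this, Del_smul N κ ((Sm.pow p).mul s), Del_mul N (Sm.pow p) s,
      Del_mul N (hb.iter j) (hy.iter k), deriv_iter_mul j k hb hy,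
      Function.iterate_succ_apply' _ j, Function.iterate_succ_apply' _ k]
  have key2 : ∀ (k : ℕ) (y : ℝ → ℝ) (z : ℝ), Del N (deriv^[k] y) z
      = z * deriv^[k + 2] y z + N / 2 * deriv^[k + 1] y z := by
    intro k y z
    rw [Function.iterate_succ_apply', Function.iterate_succ_apply']; rfl
  rcases p with _ | p
  · refine ⟨[(κ, 1, j, k + 2), (κ * (N / 2), 0, j, k + 1), (2 * κ, 1, j + 1, k + 1),
      (κ, 1, j + 2, k), (κ * (N / 2), 0, j + 1, k)], ?_, ?_⟩
    · intro r hr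
      simp only [List.mem_cons, List.not_mem_nil, or_false] at hr
      rcases hr with rfl | rfl | rfl | rfl | rfl <;> simp only [ok] <;> omega
    · intro b y hb hy
      funext z
      rw [key b y hb hy z, Del_pow_zero, key2, key2]
      have : deriv (fun z : ℝ => z ^ 0) z = 0 := by simp
      rw [this]
      simp only [ev, tm, List.map_cons, List.map_nil, List.sum_cons, List.sum_nil]
      ring
  · refine ⟨[(κ, p + 2, j, k + 2), (κ * (N / 2), p + 1, j, k + 1), (2 * κ, p + 2, j + 1, k + 1),
      (κ, p + 2, j + 2, k), (κ * (N / 2), p + 1, j + 1, k),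
      (2 * (p + 1) * κ, p + 1, j + 1, k), (2 * (p + 1) * κ, p + 1, j, k + 1),
      (((p + 1) * p + N / 2 * (p + 1)) * κ, p, j, k)], ?_, ?_⟩
    · intro r hr
      simp only [List.mem_cons, List.not_mem_nil, or_false] at hr
      rcases hr with rfl | rfl | rfl | rfl | rfl | rfl | rfl | rfl <;> simp only [ok] <;> omega
    · intro b y hb hy
      funext z
      rw [key b y hb hy z, Del_pow_succ, key2, key2]
      have : deriv (fun z : ℝ => z ^ (p + 1)) z = (p + 1) * z ^ p := by
        rw [(hasDerivAt_pow (p + 1) z).deriv]; push_cast; simp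
      rw [this]
      simp only [ev, tm, List.map_cons, List.map_nil, List.sum_cons, List.sum_nil]
      ring

lemma ev_append (L L' : List (ℝ × ℕ × ℕ × ℕ)) (b y : ℝ → ℝ) (z : ℝ) :
    ev (L ++ L') b y z = ev L b y z + ev L' b y z := by
  simp [ev]

lemma evE_append (L L' : List (ℝ × ℕ × ℕ × ℕ)) (b y : ℝ → ℝ) (z : ℝ) :
    evE (L ++ L') b y z = evE L b y z + evE L' b y z := by
  simp [evE]

lemma Del_ev (N : ℝ) (m : ℕ) (L : List (ℝ × ℕ × ℕ × ℕ)) (hL : ∀ q ∈ L, ok m q) :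
    ∃ L' : List (ℝ × ℕ × ℕ × ℕ), (∀ r ∈ L', ok (m + 1) r) ∧ ∀ b y : ℝ → ℝ, Sm b → Sm y →
      Del N (ev L b y) = ev L' b y := by
  induction L with
  | nil =>
    refine ⟨[], by simp, fun b y _ _ => ?_⟩
    have : ev [] b y = fun _ => 0 := by funext z; simp [ev]
    rw [this]; funext z; simp [Del]
  | cons q L ih =>
    obtain ⟨L1, h1, e1⟩ := Del_tm N m q (hL q (by simp))
    obtain ⟨L2, h2, e2⟩ := ih (fun r hr => hL r (by simp [hr]))
    refine ⟨L1 ++ L2, ?_, fun b y hb hy => ?_⟩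
    · intro r hr
      rcases List.mem_append.1 hr with h | h
      · exact h1 r h
      · exact h2 r h
    · funext z
      have : ev (q :: L) b y = fun z => tm q b y z + ev L b y z := by
        funext z; simp [ev]
      rw [this, Del_add N (Sm.tm q hb hy) (Sm.ev L hb hy), e1 b y hb hy, e2 b y hb hy, ev_append]

/-- Lists for the even commutators. -/
lemma comm_even (N : ℝ) (m : ℕ) :
    ∃ L : List (ℝ × ℕ × ℕ × ℕ), (∀ r ∈ L, ok m r) ∧ ∀ b y : ℝ → ℝ, Sm b → Sm y →
      DelIter N m (fun z => b z * y z) = fun z => b z * DelIter N m y z + ev L b y z := by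
  -- we also need `b' Δ^m y` and `Δ b Δ^m y` expanded, so expand `Δ^m y` with a list first
  have exp : ∀ m : ℕ, ∃ E : List (ℝ × ℕ × ℕ), (∀ r ∈ E, 2 * r.2.1 ≤ r.2.2 ∧ r.2.2 = r.2.1 + m) ∧
      ∀ y : ℝ → ℝ, Sm y →
        DelIter N m y = fun z => (E.map fun r => r.1 * (z ^ r.2.1 * deriv^[r.2.2] y z)).sum := by
    intro m
    induction m with
    | zero =>
      refine ⟨[(1, 0, 0)], by simp, fun y hy => ?_⟩
      funext z; simp [DelIter]
    | succ m ih =>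
      obtain ⟨E, hE, e⟩ := ih
      have step : ∀ E : List (ℝ × ℕ × ℕ), (∀ r ∈ E, 2 * r.2.1 ≤ r.2.2 ∧ r.2.2 = r.2.1 + m) →
          ∃ E' : List (ℝ × ℕ × ℕ),
            (∀ r ∈ E', 2 * r.2.1 ≤ r.2.2 ∧ r.2.2 = r.2.1 + (m + 1)) ∧ ∀ y : ℝ → ℝ, Sm y →
            Sm (fun z => (E.map fun r => r.1 * (z ^ r.2.1 * deriv^[r.2.2] y z)).sum) ∧
            Del N (fun z => (E.map fun r => r.1 * (z ^ r.2.1 * deriv^[r.2.2] y z)).sum)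
              = fun z => (E'.map fun r => r.1 * (z ^ r.2.1 * deriv^[r.2.2] y z)).sum := by
        intro E
        induction E with
        | nil =>
          intro _
          refine ⟨[], by simp, fun y hy => ⟨?_, ?_⟩⟩
          · simpa using Sm.const 0
          · funext z; simp [Del]
        | cons r E ih =>
          intro hE
          obtain ⟨E2, h2, e2⟩ := ih (fun q hq => hE q (by simp [hq]))
          obtain ⟨κ, p, k⟩ := r
          have hr := hE (κ, p, k) (by simp)
          simp only at hr
          obtain ⟨E1, h1, e1⟩ : ∃ E1 : List (ℝ × ℕ × ℕ),
              (∀ r ∈ E1, 2 * r.2.1 ≤ r.2.2 ∧ r.2.2 = r.2.1 + (m + 1)) ∧ ∀ y : ℝ → ℝ, Sm y →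
              ∀ z, Del N (fun z => κ * (z ^ p * deriv^[k] y z)) z
                = (E1.map fun r => r.1 * (z ^ r.2.1 * deriv^[r.2.2] y z)).sum := by
            have key2 : ∀ (k : ℕ) (y : ℝ → ℝ) (z : ℝ), Del N (deriv^[k] y) z
                = z * deriv^[k + 2] y z + N / 2 * deriv^[k + 1] y z := by
              intro k y z
              rw [Function.iterate_succ_apply', Function.iterate_succ_apply']; rfl
            rcases p with _ | p
            · refine ⟨[(κ, 1, k + 2), (κ * (N / 2), 0, k + 1)], ?_, ?_⟩
              · intro r hr
                simp only [List.mem_cons, List.not_mem_nil, or_false] at hr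
                rcases hr with rfl | rfl <;> simp only <;> omega
              · intro y hy z
                rw [Del_smul N κ ((Sm.pow 0).mul (hy.iter k)), Del_mul N (Sm.pow 0) (hy.iter k),
                  Del_pow_zero, key2]
                have : deriv (fun z : ℝ => z ^ 0) z = 0 := by simp
                rw [this]
                simp only [List.map_cons, List.map_nil, List.sum_cons, List.sum_nil]
                ring
            · refine ⟨[(κ, p + 2, k + 2), (κ * (N / 2), p + 1, k + 1),
                (2 * (p + 1) * κ, p + 1, k + 1),
                (((p + 1) * p + N / 2 * (p + 1)) * κ, p, k)], ?_, ?_⟩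
              · intro r hr
                simp only [List.mem_cons, List.not_mem_nil, or_false] at hr
                rcases hr with rfl | rfl | rfl | rfl <;> simp only <;> omega
              · intro y hy z
                rw [Del_smul N κ ((Sm.pow _).mul (hy.iter k)), Del_mul N (Sm.pow _) (hy.iter k),
                  Del_pow_succ, key2]
                have : deriv (fun z : ℝ => z ^ (p + 1)) z = (p + 1) * z ^ p := by
                  rw [(hasDerivAt_pow (p + 1) z).deriv]; push_cast; simp
                rw [this, ← Function.iterate_succ_apply' deriv k y]
                simp only [List.map_cons, List.map_nil, List.sum_cons, List.sum_nil,
                  Nat.succ_eq_add_one]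
                ring
          refine ⟨E1 ++ E2, ?_, fun y hy => ?_⟩
          · intro r hr
            rcases List.mem_append.1 hr with h | h
            · exact h1 r h
            · exact h2 r h
          · obtain ⟨s, e2'⟩ := e2 y hy
            have s1 : Sm (fun z => κ * (z ^ p * deriv^[k] y z)) :=
              (Sm.const κ).mul ((Sm.pow p).mul (hy.iter k))
            refine ⟨?_, ?_⟩
            · simpa using s1.add s
            · funext z
              have := Del_add N s1 s z
              simp only [List.map_cons, List.sum_cons, List.map_append, List.sum_append]
              rw [this, e1 y hy, e2']
      obtain ⟨E', hE', e'⟩ := step E hE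
      refine ⟨E', hE', fun y hy => ?_⟩
      show Del N (DelIter N m y) = _
      rw [e y hy, (e' y hy).2]
  induction m with
  | zero =>
    refine ⟨[], by simp, fun b y hb hy => ?_⟩
    funext z; simp [DelIter, ev]
  | succ m ih =>
    obtain ⟨L, hL, e⟩ := ih
    obtain ⟨L1, hL1, e1⟩ := Del_ev N m L hL
    -- the terms `2 z b' (Δ^m y)' + Δb Δ^m y`
    obtain ⟨E, hE, eE⟩ := exp m
    have step : ∀ E : List (ℝ × ℕ × ℕ), (∀ r ∈ E, 2 * r.2.1 ≤ r.2.2 ∧ r.2.2 = r.2.1 + m) →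
        ∃ L : List (ℝ × ℕ × ℕ × ℕ), (∀ r ∈ L, ok (m + 1) r) ∧ ∀ b y : ℝ → ℝ, Sm b → Sm y →
          Differentiable ℝ (fun z => (E.map fun r => r.1 * (z ^ r.2.1 * deriv^[r.2.2] y z)).sum) ∧
          ∀ z, 2 * z * deriv b z
              * deriv (fun z => (E.map fun r => r.1 * (z ^ r.2.1 * deriv^[r.2.2] y z)).sum) z
            + Del N b z * (E.map fun r => r.1 * (z ^ r.2.1 * deriv^[r.2.2] y z)).sum
            = ev L b y z := by
      intro E
      induction E with
      | nil =>
        intro _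
        refine ⟨[], by simp, fun b y hb hy => ⟨?_, ?_⟩⟩
        · simp
        · intro z; simp [ev]
      | cons r E ih =>
        intro hE
        obtain ⟨L2, h2, e2⟩ := ih (fun q hq => hE q (by simp [hq]))
        obtain ⟨κ, p, k⟩ := r
        have hr := hE (κ, p, k) (by simp)
        simp only at hr
        refine ⟨[(2 * κ, p + 1, 1, k + 1), (2 * p * κ, p, 1, k), (κ, p + 1, 2, k),
          (κ * (N / 2), p, 1, k)] ++ L2, ?_, fun b y hb hy => ?_⟩
        · intro r hr'
          rcases List.mem_append.1 hr' with h | h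
          · simp only [List.mem_cons, List.not_mem_nil, or_false] at h
            rcases h with rfl | rfl | rfl | rfl <;> simp only [ok] <;> omega
          · exact h2 r h
        · obtain ⟨s, e2'⟩ := e2 b y hb hy
          have s1 : Sm (fun z => κ * (z ^ p * deriv^[k] y z)) :=
            (Sm.const κ).mul ((Sm.pow p).mul (hy.iter k))
          refine ⟨?_, ?_⟩
          · simpa using s1.diff.fun_add s
          · intro z
            rw [ev_append, ← e2' z]
            simp only [List.map_cons, List.sum_cons]
            have d1 := (s1.hd z).add (s z).hasDerivAt
            have d2 : deriv (fun z => κ * (z ^ p * deriv^[k] y z)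
              + (E.map fun r => r.1 * (z ^ r.2.1 * deriv^[r.2.2] y z)).sum) z = _ := d1.deriv
            have d3 : deriv (fun z => κ * (z ^ p * deriv^[k] y z)) z
                = κ * (p * z ^ (p - 1) * deriv^[k] y z + z ^ p * deriv^[k + 1] y z) := by
              rw [Function.iterate_succ_apply']
              exact (((hasDerivAt_pow p z).mul ((hy.iter k).hd z)).const_mul κ).deriv
            have d4 : z * (p * z ^ (p - 1)) = p * z ^ p := by
              rcases p with _ | p
              · simp
              · simp only [Nat.add_sub_cancel]; ring
            rw [d2, d3]
            simp only [ev, tm, List.map_cons, List.map_nil, List.sum_cons, List.sum_nil, Del]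
            have d5 : deriv^[1] b z = deriv b z := rfl
            have d6 : deriv^[2] b z = deriv (deriv b) z := rfl
            rw [d5, d6]
            linear_combination (2 * κ * deriv b z * deriv^[k] y z) * d4
    obtain ⟨L2, hL2, e2⟩ := step E hE
    refine ⟨L1 ++ L2, ?_, fun b y hb hy => ?_⟩
    · intro r hr
      rcases List.mem_append.1 hr with h | h
      · exact hL1 r h
      · exact hL2 r h
    · funext z
      show Del N (DelIter N m _) z = _
      have sy := hy.delIter N m
      rw [e b y hb hy, Del_add N (hb.mul sy) (Sm.ev L hb hy), e1 b y hb hy, Del_mul N hb sy,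
        ev_append, ← (e2 b y hb hy).2 z, ← eE y hy]
      have : (E.map fun r => r.1 * (z ^ r.2.1 * deriv^[r.2.2] y z)).sum = DelIter N m y z := by
        rw [eE y hy]
      rw [this]
      show _ = b z * Del N (DelIter N m y) z + _
      ring


/-- The tame bilinear bound of order `ℓ`. -/
noncomputable def Bs (N : ℝ) (ℓ : ℕ) (b y : ℝ → ℝ) : ℝ :=
  ∑ i ∈ Finset.range ℓ, supN (Ddot^[i + 1] b) * gnorm N (ℓ - 1 - i) y

lemma Bs_nonneg (N : ℝ) (ℓ : ℕ) (b y : ℝ → ℝ) : 0 ≤ Bs N ℓ b y :=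
  Finset.sum_nonneg fun _ _ => mul_nonneg (supN_nonneg _) (gnorm_nonneg _ _ _)

lemma le_Bs (N : ℝ) {ℓ i k : ℕ} (hi : 1 ≤ i) (hk : i + k = ℓ) (b y : ℝ → ℝ) :
    supN (Ddot^[i] b) * gnorm N k y ≤ Bs N ℓ b y := by
  have := Finset.single_le_sum
    (f := fun i => supN (Ddot^[i + 1] b) * gnorm N (ℓ - 1 - i) y) (s := Finset.range ℓ)
    (fun _ _ => mul_nonneg (supN_nonneg _) (gnorm_nonneg _ _ _))
    (Finset.mem_range.2 (by omega : i - 1 < ℓ))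
  rwa [show i - 1 + 1 = i by omega, show ℓ - 1 - (i - 1) = k by omega] at this

lemma tmE_bound {N : ℝ} (hN : 4 ≤ N) (ℓ : ℕ) (q : ℝ × ℕ × ℕ × ℕ) (hq : okE ℓ q) :
    ∃ C > (0:ℝ), ∀ b y : ℝ → ℝ, Sm b → Sm y → Xnorm N (tmE q b y) ≤ C * Bs N ℓ b y := by
  obtain ⟨κ, e, j, k⟩ := q
  simp only [okE] at hq
  obtain ⟨h1, h2, h3⟩ := hq
  obtain ⟨α, β, hα, hβ, hαβ⟩ : ∃ α β : ℕ, α ≤ j ∧ β ≤ k ∧ e = α + β := by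
    rcases Nat.le_total e j with h | h
    · exact ⟨e, 0, h, by omega, by omega⟩
    · exact ⟨j, e - j, le_rfl, by omega, by omega⟩
  obtain ⟨C, hC, hC2⟩ := sup_bound j j α le_rfl hα
  refine ⟨(|κ| + 1) * C, by positivity, fun b y hb hy => ?_⟩
  have hs := supN_nonneg (Ddot^[2 * j - α] b)
  have c1 : Continuous (fun z => Real.sqrt z ^ β * deriv^[k] y z) :=
    (Real.continuous_sqrt.pow _).mul (hy.iter k).cont
  have hA : Xnorm N (tmE (κ, e, j, k) b y)
      ≤ (|κ| * (C * supN (Ddot^[2 * j - α] b))) * Xnorm N (fun z => Real.sqrt z ^ β * deriv^[k] y z) := by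
    apply X_mono (by linarith) (tmE_cont _ hb hy) c1 (by positivity)
    intro z hz
    have hb1 := hC2 b hb _ hs (fun z hz => DD_le_supN _ hb hz) z ⟨hz.1, hz.2.le⟩
    have e1 : tmE (κ, e, j, k) b y z
        = κ * ((Real.sqrt z ^ α * deriv^[j] b z) * (Real.sqrt z ^ β * deriv^[k] y z)) := by
      simp only [tmE, hαβ, pow_add]; ring
    rw [e1, abs_mul, abs_mul (Real.sqrt z ^ α * deriv^[j] b z), mul_assoc]
    apply mul_le_mul_of_nonneg_left _ (abs_nonneg _)
    apply mul_le_mul_of_nonneg_right _ (abs_nonneg _)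
    rw [abs_mul, abs_of_nonneg (pow_nonneg (Real.sqrt_nonneg z) α)]
    exact hb1
  rw [X_shift] at hA
  have hB := iter_bound hN k k β le_rfl hβ y hy
  have hD := le_Bs N (ℓ := ℓ) (i := 2 * j - α) (k := 2 * k - β) (by omega) (by omega) b y
  have hB0 := Bs_nonneg N ℓ b y
  calc Xnorm N (tmE (κ, e, j, k) b y)
      ≤ (|κ| * (C * supN (Ddot^[2 * j - α] b))) * gnorm N (2 * k - β) y :=
        hA.trans (mul_le_mul_of_nonneg_left hB (by positivity))
    _ = |κ| * C * (supN (Ddot^[2 * j - α] b) * gnorm N (2 * k - β) y) := by ring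
    _ ≤ |κ| * C * Bs N ℓ b y := mul_le_mul_of_nonneg_left hD (by positivity)
    _ ≤ (|κ| + 1) * C * Bs N ℓ b y := by
        apply mul_le_mul_of_nonneg_right _ hB0
        nlinarith

lemma evE_bound {N : ℝ} (hN : 4 ≤ N) (ℓ : ℕ) (L : List (ℝ × ℕ × ℕ × ℕ)) (hL : ∀ q ∈ L, okE ℓ q) :
    ∃ C > (0:ℝ), ∀ b y : ℝ → ℝ, Sm b → Sm y → Xnorm N (evE L b y) ≤ C * Bs N ℓ b y := by
  induction L with
  | nil =>
    refine ⟨1, one_pos, fun b y hb hy => ?_⟩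
    have : Xnorm N (evE [] b y) = 0 := by
      simp [Xnorm, evE]
    rw [this, one_mul]; exact Bs_nonneg _ _ _ _
  | cons q L ih =>
    obtain ⟨C1, h1, e1⟩ := tmE_bound hN ℓ q (hL q (by simp))
    obtain ⟨C2, h2, e2⟩ := ih (fun r hr => hL r (by simp [hr]))
    refine ⟨C1 + C2, by positivity, fun b y hb hy => ?_⟩
    have : evE (q :: L) b y = fun z => tmE q b y z + evE L b y z := by
      funext z; simp [evE]
    rw [this, add_mul]
    exact (X_add (by linarith) (tmE_cont q hb hy) (evE_cont L hb hy)).trans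
      (add_le_add (e1 b y hb hy) (e2 b y hb hy))

lemma ev_evE (m : ℕ) (L : List (ℝ × ℕ × ℕ × ℕ)) (hL : ∀ q ∈ L, ok m q) :
    ∃ L' : List (ℝ × ℕ × ℕ × ℕ), (∀ q ∈ L', okE (2 * m) q) ∧
      ∀ b y : ℝ → ℝ, ∀ z, 0 < z → ev L b y z = evE L' b y z := by
  induction L with
  | nil => exact ⟨[], by simp, fun b y z hz => by simp [ev, evE]⟩
  | cons q L ih =>
    obtain ⟨L2, h2, e2⟩ := ih (fun r hr => hL r (by simp [hr]))
    obtain ⟨κ, p, j, k⟩ := q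
    have hq := hL (κ, p, j, k) (by simp)
    simp only [ok] at hq
    refine ⟨(κ, 2 * p, j, k) :: L2, ?_, fun b y z hz => ?_⟩
    · intro r hr
      rcases List.mem_cons.1 hr with rfl | h
      · simp only [okE]; omega
      · exact h2 r h
    · have := e2 b y z hz
      simp only [ev, evE, List.map_cons, List.sum_cons] at this ⊢
      rw [this]
      simp only [tm, tmE, pow_mul, Real.sq_sqrt hz.le]

lemma Ddot_ev (m : ℕ) (L : List (ℝ × ℕ × ℕ × ℕ)) (hL : ∀ q ∈ L, ok m q) :
    ∃ L' : List (ℝ × ℕ × ℕ × ℕ), (∀ q ∈ L', okE (2 * m + 1) q) ∧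
      ∀ b y : ℝ → ℝ, Sm b → Sm y → ∀ z, 0 < z → Ddot (ev L b y) z = evE L' b y z := by
  induction L with
  | nil =>
    refine ⟨[], by simp, fun b y _ _ z hz => ?_⟩
    have : ev [] b y = fun _ => 0 := by funext z; simp [ev]
    rw [this]; simp [Ddot, evE]
  | cons q L ih =>
    obtain ⟨L2, h2, e2⟩ := ih (fun r hr => hL r (by simp [hr]))
    obtain ⟨κ, p, j, k⟩ := q
    have hq := hL (κ, p, j, k) (by simp)
    simp only [ok] at hq
    obtain ⟨L1, h1, e1⟩ : ∃ L1 : List (ℝ × ℕ × ℕ × ℕ), (∀ q ∈ L1, okE (2 * m + 1) q) ∧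
      ∀ b y : ℝ → ℝ, Sm b → Sm y → ∀ z, 0 < z → Ddot (tm (κ, p, j, k) b y) z = evE L1 b y z := by
      have d3 : ∀ b y : ℝ → ℝ, Sm b → Sm y → ∀ z, deriv (tm (κ, p, j, k) b y) z
          = κ * (p * z ^ (p - 1) * (deriv^[j] b z * deriv^[k] y z)
            + z ^ p * (deriv^[j + 1] b z * deriv^[k] y z + deriv^[j] b z * deriv^[k + 1] y z)) := by
        intro b y hb hy z
        rw [← deriv_iter_mul j k hb hy]
        exact (((hasDerivAt_pow p z).mul (((hb.iter j).mul (hy.iter k)).hd z)).const_mul κ).deriv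
      rcases p with _ | p
      · refine ⟨[(κ, 1, j + 1, k), (κ, 1, j, k + 1)], ?_, ?_⟩
        · intro r hr
          simp only [List.mem_cons, List.not_mem_nil, or_false] at hr
          rcases hr with rfl | rfl <;> simp only [okE] <;> omega
        · intro b y hb hy z hz
          simp only [Ddot]
          rw [d3 b y hb hy]
          simp only [evE, tmE, List.map_cons, List.map_nil, List.sum_cons, List.sum_nil]
          push_cast
          ring
      · refine ⟨[((p + 1) * κ, 2 * p + 1, j, k), (κ, 2 * p + 3, j + 1, k),
          (κ, 2 * p + 3, j, k + 1)], ?_, ?_⟩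
        · intro r hr
          simp only [List.mem_cons, List.not_mem_nil, or_false] at hr
          rcases hr with rfl | rfl | rfl <;> simp only [okE] <;> omega
        · intro b y hb hy z hz
          simp only [Ddot]
          rw [d3 b y hb hy]
          have a1 : Real.sqrt z ^ (2 * p + 1) = Real.sqrt z * z ^ p := by
            rw [pow_succ, pow_mul, Real.sq_sqrt hz.le]; ring
          have a2 : Real.sqrt z ^ (2 * p + 3) = Real.sqrt z * z ^ (p + 1) := by
            rw [show 2 * p + 3 = 2 * (p + 1) + 1 by ring, pow_succ, pow_mul, Real.sq_sqrt hz.le]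
            ring
          simp only [evE, tmE, List.map_cons, List.map_nil, List.sum_cons, List.sum_nil, a1, a2,
            Nat.add_sub_cancel]
          push_cast
          ring
    refine ⟨L1 ++ L2, ?_, fun b y hb hy z hz => ?_⟩
    · intro r hr
      rcases List.mem_append.1 hr with h | h
      · exact h1 r h
      · exact h2 r h
    · rw [evE_append, ← e1 b y hb hy z hz, ← e2 b y hb hy z hz]
      have : ev ((κ, p, j, k) :: L) b y = fun z => tm (κ, p, j, k) b y z + ev L b y z := by
        funext z; simp [ev]
      rw [this]
      simp only [Ddot]
      rw [(((Sm.tm (κ, p, j, k) hb hy).hd z).fun_add ((Sm.ev L hb hy).hd z)).deriv]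
      ring

lemma comm_bound {N : ℝ} (hN : 4 ≤ N) (ℓ : ℕ) :
    ∃ C > (0:ℝ), ∀ b y : ℝ → ℝ, Sm b → Sm y →
      Xnorm N (fun z => DD N ℓ (fun z => b z * y z) z - b z * DD N ℓ y z) ≤ C * Bs N ℓ b y := by
  rcases Nat.even_or_odd' ℓ with ⟨m, rfl | rfl⟩
  · obtain ⟨L, hL, e⟩ := comm_even N m
    obtain ⟨L', hL', e'⟩ := ev_evE m L hL
    obtain ⟨C, hC, hb⟩ := evE_bound hN _ L' hL'
    refine ⟨C, hC, fun b y sb sy => ?_⟩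
    refine le_trans (le_of_eq ?_) (hb b y sb sy)
    apply X_congr
    intro z hz
    rw [DD_even, DD_even, e b y sb sy, ← e' b y z hz.1]; ring
  · obtain ⟨L, hL, e⟩ := comm_even N m
    obtain ⟨L', hL', e'⟩ := Ddot_ev m L hL
    obtain ⟨C, hC, hb⟩ := evE_bound hN _ L' hL'
    refine ⟨C + 1, by positivity, fun b y sb sy => ?_⟩
    have su := sy.delIter N m
    have c2 : Continuous (fun z => Ddot b z * DelIter N m y z) := sb.ddot.mul su.cont
    have h1 : Xnorm N (fun z => DD N (2 * m + 1) (fun z => b z * y z) z - b z * DD N (2 * m + 1) y z)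
        = Xnorm N (fun z => evE L' b y z + Ddot b z * DelIter N m y z) := by
      apply X_congr
      intro z hz
      rw [DD_odd, DD_odd, e b y sb sy, ← e' b y sb sy z hz.1]
      simp only [Ddot]
      have d := (((sb.hd z).fun_mul (su.hd z)).fun_add ((Sm.ev L sb sy).hd z)).deriv
      rw [d]; ring
    rw [h1]
    refine (X_add (by linarith) (evE_cont L' sb sy) c2).trans ?_
    have h2 : Xnorm N (fun z => Ddot b z * DelIter N m y z)
        ≤ supN (Ddot^[1] b) * Xnorm N (DelIter N m y) := by
      apply X_mono (by linarith) c2 su.cont (supN_nonneg _)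
      intro z hz
      rw [abs_mul]
      apply mul_le_mul_of_nonneg_right _ (abs_nonneg _)
      exact le_supN 1 sb ⟨hz.1.le, hz.2.le⟩
    have h3 := le_Bs N (ℓ := 2 * m + 1) (i := 1) (k := 2 * m) le_rfl (by ring) b y
    rw [gnorm_eq, DD_even] at h3
    have h4 := hb b y sb sy
    linarith

lemma prod_bound {N : ℝ} (hN : 4 ≤ N) (ℓ : ℕ) :
    ∃ C > (0:ℝ), ∀ b y : ℝ → ℝ, Sm b → Sm y →
      gnorm N ℓ (fun z => b z * y z)
        ≤ C * ∑ i ∈ Finset.range (ℓ + 1), supN (Ddot^[i] b) * gnorm N (ℓ - i) y := by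
  obtain ⟨C, hC, h⟩ := comm_bound hN ℓ
  refine ⟨C + 1, by positivity, fun b y sb sy => ?_⟩
  have h1 := h b y sb sy
  have cD := DD_cont N ℓ sy
  have cb := sb.cont
  have cP := DD_cont N ℓ (sb.mul sy)
  have cM : Continuous (fun z => b z * DD N ℓ y z) := cb.mul cD
  have cS : Continuous (fun z => DD N ℓ (fun z => b z * y z) z - b z * DD N ℓ y z) := cP.sub cM
  have h2 : Xnorm N (fun z => b z * DD N ℓ y z) ≤ supN (Ddot^[0] b) * Xnorm N (DD N ℓ y) := by
    apply X_mono (by linarith) cM cD (supN_nonneg _)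
    intro z hz
    rw [abs_mul]
    apply mul_le_mul_of_nonneg_right _ (abs_nonneg _)
    exact le_supN 0 sb ⟨hz.1.le, hz.2.le⟩
  have h3 := X_add (N := N) (by linarith) cS cM
  have h4 : gnorm N ℓ (fun z => b z * y z)
      ≤ C * Bs N ℓ b y + supN (Ddot^[0] b) * gnorm N ℓ y := by
    rw [gnorm_eq, gnorm_eq]
    simp only [sub_add_cancel] at h3
    change _ ≤ Xnorm N (fun z => DD N ℓ (fun z => b z * y z) z - b z * DD N ℓ y z)
      + Xnorm N (fun z => b z * DD N ℓ y z) at h3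
    linarith
  rw [Finset.sum_range_succ']
  have h5 : ∑ i ∈ Finset.range ℓ, supN (Ddot^[i + 1] b) * gnorm N (ℓ - (i + 1)) y = Bs N ℓ b y := by
    unfold Bs
    apply Finset.sum_congr rfl
    intro i hi
    rw [show ℓ - (i + 1) = ℓ - 1 - i by omega]
  rw [h5, Nat.sub_zero]
  have n1 := Bs_nonneg N ℓ b y
  have n2 := mul_nonneg (supN_nonneg (Ddot^[0] b)) (gnorm_nonneg N ℓ y)
  nlinarith


/-- Rescaled version of the abstract interpolation inequality. -/
lemma abs_interp_scaled (K : ℕ) (D : ℝ) (hD : 0 < D) (η : ℝ) (hη : 0 < η) :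
    ∃ C > (0:ℝ), ∀ s : ℕ → ℝ, (∀ k, 0 ≤ s k) →
      (∀ k, ∀ δ : ℝ, 0 < δ → δ ≤ 1 → s (k + 1) ≤ D / δ * s k + δ * s (k + 2)) →
      ∀ L : ℝ, 1 ≤ L → ∀ k ≤ K, s k / L ^ k ≤ η * (s (K + 1) / L ^ (K + 1)) + C * s 0 := by
  obtain ⟨C, hC, h⟩ := abs_interp K D hD η hη
  refine ⟨C, hC, fun s hs hstep L hL k hk => ?_⟩
  have hL0 : 0 < L := by linarith
  have := h (fun k => s k / L ^ k) (fun k => div_nonneg (hs k) (by positivity)) ?_ k hk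
  · simpa using this
  · intro k _ δ hδ hδ1
    have h1 := hstep k (δ / L) (by positivity) ((div_le_one hL0).2 (by linarith))
    rw [div_le_iff₀ (by positivity)]
    refine h1.trans (le_of_eq ?_)
    field_simp
    ring

lemma b_interp (n : ℕ) (M : ℝ) (hM : 0 < M) : ∃ C > (0:ℝ), ∀ b : ℝ → ℝ, Sm b →
    ∀ L : ℝ, 1 ≤ L → supN (Ddot^[0] b) ≤ M → supN (Ddot^[n + 1] b) ≤ L ^ (n + 1) →
      ∀ i ≤ n + 1, supN (Ddot^[i] b) ≤ C * L ^ i := by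
  obtain ⟨C, hC, h⟩ := abs_interp_scaled n 2 (by norm_num) 1 one_pos
  refine ⟨1 + C * M, by positivity, fun b sb L hL h0 h1 i hi => ?_⟩
  have hL0 : 0 < L := by linarith
  have hp : 0 < L ^ i := by positivity
  rcases Nat.lt_or_ge n i with h2 | h2
  · have : i = n + 1 := by omega
    subst this
    have : 0 ≤ C * M * L ^ (n + 1) := by positivity
    nlinarith
  · have h3 := h (fun k => supN (Ddot^[k] b)) (fun k => supN_nonneg _)
      (fun k δ hδ hδ1 => sup_interp k sb hδ hδ1) L hL i h2
    have h4 : supN (Ddot^[n + 1] b) / L ^ (n + 1) ≤ 1 := (div_le_one (by positivity)).2 h1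
    rw [← div_le_iff₀ hp]
    have h5 : C * supN (Ddot^[0] b) ≤ C * M := mul_le_mul_of_nonneg_left h0 hC.le
    linarith

lemma h_interp {N : ℝ} (hN : 2 ≤ N) (n : ℕ) (η : ℝ) (hη : 0 < η) : ∃ C > (0:ℝ), ∀ h : ℝ → ℝ, Sm h →
    ∀ L : ℝ, 1 ≤ L → ∀ i m : ℕ, i ≤ n + 1 → m ≤ n + 1 → i + m ≤ n + 2 →
      L ^ i * normN N m h ≤ η * normN N (n + 2) h + C * (L ^ (n + 1) * normN N 1 h) := by
  obtain ⟨C, hC, H⟩ := abs_interp_scaled n (N + 8) (by linarith) η hη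
  refine ⟨C, hC, fun h sh L hL => ?_⟩
  have hL0 : 0 < L := by linarith
  have key : ∀ i k : ℕ, k ≤ n → i + k ≤ n + 1 →
      L ^ i * normN N (k + 1) h ≤ η * normN N (n + 2) h + C * (L ^ (n + 1) * normN N 1 h) := by
    intro i k hk hik
    have h3 := H (fun k => normN N (k + 1) h) (fun k => normN_nonneg _ _ _)
      (fun k δ hδ hδ1 => norm_interp hN (k + 1) sh hδ) L hL k hk
    have hn := normN_nonneg N (k + 1) h
    have h4 : L ^ i * L ^ k ≤ L ^ (n + 1) := by
      rw [← pow_add]; exact pow_le_pow_right₀ hL hik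
    have h5 : L ^ i * normN N (k + 1) h ≤ L ^ (n + 1) * (normN N (k + 1) h / L ^ k) := by
      rw [← mul_div_assoc, le_div_iff₀ (by positivity)]
      nlinarith
    refine h5.trans ((mul_le_mul_of_nonneg_left h3 (by positivity)).trans (le_of_eq ?_))
    rw [zero_add]
    field_simp
  intro i m hi hm him
  rcases m with _ | m
  · refine (mul_le_mul_of_nonneg_left (normN_mono N (Nat.zero_le 1) h) (by positivity)).trans ?_
    exact key i 0 (by omega) (by omega)
  · exact key i m (by omega) (by omega)

lemma Del_local (N : ℝ) {f g : ℝ → ℝ} {s : Set ℝ} (hs : IsOpen s) (h : ∀ z ∈ s, f z = g z) :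
    ∀ z ∈ s, Del N f z = Del N g z := by
  intro z hz
  have e : f =ᶠ[nhds z] g := by
    filter_upwards [hs.mem_nhds hz] with x hx using h x hx
  unfold Del
  rw [e.deriv_eq, e.deriv.deriv_eq]

lemma DelIter_local (N : ℝ) (m : ℕ) {f g : ℝ → ℝ} {s : Set ℝ} (hs : IsOpen s)
    (h : ∀ z ∈ s, f z = g z) : ∀ z ∈ s, DelIter N m f z = DelIter N m g z := by
  induction m with
  | zero => exact h
  | succ m ih => exact Del_local N hs ih

lemma DD_local (N : ℝ) (ℓ : ℕ) {f g : ℝ → ℝ} {s : Set ℝ} (hs : IsOpen s)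
    (h : ∀ z ∈ s, f z = g z) : ∀ z ∈ s, DD N ℓ f z = DD N ℓ g z := by
  intro z hz
  unfold DD; split_ifs
  · exact DelIter_local N _ hs h z hz
  · have e : DelIter N (ℓ / 2) f =ᶠ[nhds z] DelIter N (ℓ / 2) g := by
      filter_upwards [hs.mem_nhds hz] with x hx using DelIter_local N _ hs h x hx
    unfold Ddot
    rw [e.deriv_eq]

lemma gnorm_local (N : ℝ) (ℓ : ℕ) {f g : ℝ → ℝ} (h : ∀ z ∈ Ioo (0:ℝ) 1, f z = g z) :
    gnorm N ℓ f = gnorm N ℓ g := by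
  rw [gnorm_eq, gnorm_eq]
  exact X_congr N (DD_local N ℓ isOpen_Ioo h)

lemma gnorm_add {N : ℝ} (hN : 2 ≤ N) (ℓ : ℕ) {f g : ℝ → ℝ} (hf : Sm f) (hg : Sm g) :
    gnorm N ℓ (fun z => f z + g z) ≤ gnorm N ℓ f + gnorm N ℓ g := by
  rw [gnorm_eq, gnorm_eq, gnorm_eq, DD_add N ℓ hf hg]
  exact X_add hN (DD_cont N ℓ hf) (DD_cont N ℓ hg)

lemma gnorm_sub {N : ℝ} (hN : 2 ≤ N) (ℓ : ℕ) {f g : ℝ → ℝ} (hf : Sm f) (hg : Sm g) :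
    gnorm N ℓ (fun z => f z - g z) ≤ gnorm N ℓ f + gnorm N ℓ g := by
  have e : (fun z => f z - g z) = fun z => f z + (-1) * g z := by funext z; ring
  rw [e]
  have h1 := gnorm_add hN ℓ hf ((Sm.const (-1)).mul hg)
  have h2 : gnorm N ℓ (fun z => (-1) * g z) = gnorm N ℓ g := by
    rw [gnorm_eq, gnorm_eq, DD_smul N ℓ (-1) hg, X_smul]; norm_num
  rw [h2] at h1
  exact h1

lemma gnorm_Dch_unif {N : ℝ} (hN : 2 ≤ N) (n : ℕ) : ∃ C > (0:ℝ), ∀ ℓ ≤ n, ∀ h, Sm h →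
    gnorm N ℓ (fun z => z * deriv h z) ≤ C * normN N (ℓ + 1) h := by
  choose C hC h using fun ℓ => gnorm_Dch (N := N) hN ℓ
  refine ⟨∑ i ∈ Finset.range (n + 1), C i, Finset.sum_pos (fun i _ => hC i) ⟨0, by simp⟩, ?_⟩
  intro ℓ hℓ f hf
  refine (h ℓ f hf).trans (mul_le_mul_of_nonneg_right ?_ (normN_nonneg _ _ _))
  exact Finset.single_le_sum (f := C) (fun i _ => (hC i).le) (Finset.mem_range.2 (by omega))

/-- Elliptic estimate at order `ℓ` for fixed time. -/
lemma level_bound {N : ℝ} (hN : 4 ≤ N) (ℓ : ℕ) : ∃ K > (0:ℝ), ∀ b₂ b₁ b₀ h F : ℝ → ℝ,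
    Sm b₂ → Sm b₁ → Sm b₀ → Sm h → Sm F → (∀ z ∈ Icc (0:ℝ) 1, 1 / 2 ≤ b₂ z) →
    (∀ z ∈ Ioo (0:ℝ) 1, b₂ z * Del N h z = b₁ z * (z * deriv h z) + b₀ z * h z + F z) →
    ∀ R : ℝ, (∀ b : ℝ → ℝ, (b = b₂ ∨ b = b₁ ∨ b = b₀) → ∀ i m : ℕ, i ≤ ℓ + 1 → m ≤ ℓ + 1 →
      i + m ≤ ℓ + 2 → supN (Ddot^[i] b) * normN N m h ≤ R) →
    gnorm N (ℓ + 2) h ≤ K * R + 2 * gnorm N ℓ F := by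
  have hN2 : 2 ≤ N := by linarith
  obtain ⟨C1, hC1, h1⟩ := comm_bound hN ℓ
  obtain ⟨C2, hC2, h2⟩ := prod_bound hN ℓ
  obtain ⟨C3, hC3, h3⟩ := gnorm_Dch_unif hN2 ℓ
  refine ⟨2 * (C1 * ℓ + C2 * ((ℓ + 1) * C3) + C2 * (ℓ + 1)), by positivity, ?_⟩
  intro b₂ b₁ b₀ h F s2 s1 s0 sh sF hb heq R hR
  have sD := sh.del N
  have sZ : Sm (fun z => z * deriv h z) := Sm.id.mul sh.deriv
  -- commutator
  have e1 : Bs N ℓ b₂ (Del N h) ≤ ℓ * R := by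
    unfold Bs
    refine (Finset.sum_le_card_nsmul _ _ R ?_).trans (by simp)
    intro i hi
    have hi := Finset.mem_range.1 hi
    rw [← gnorm_add_two]
    refine le_trans (mul_le_mul_of_nonneg_left
      (gnorm_le_normN N (l := ℓ + 1 - i) (by omega) h) (supN_nonneg _)) ?_
    exact hR b₂ (Or.inl rfl) _ _ (by omega) (by omega) (by omega)
  have e2 : gnorm N ℓ (fun z => b₁ z * (z * deriv h z)) ≤ C2 * ((ℓ + 1) * C3) * R := by
    refine (h2 b₁ _ s1 sZ).trans ?_
    have : ∑ i ∈ Finset.range (ℓ + 1), supN (Ddot^[i] b₁) * gnorm N (ℓ - i) (fun z => z * deriv h z)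
        ≤ (ℓ + 1) * (C3 * R) := by
      refine (Finset.sum_le_card_nsmul _ _ (C3 * R) ?_).trans (by simp)
      intro i hi
      have hi := Finset.mem_range.1 hi
      refine le_trans (mul_le_mul_of_nonneg_left
        (h3 (ℓ - i) (by omega) h sh) (supN_nonneg _)) ?_
      have := hR b₁ (Or.inr (Or.inl rfl)) i (ℓ - i + 1) (by omega) (by omega) (by omega)
      have := mul_le_mul_of_nonneg_left this hC3.le
      linarith
    have := mul_le_mul_of_nonneg_left this hC2.le
    linarith
  have e3 : gnorm N ℓ (fun z => b₀ z * h z) ≤ C2 * (ℓ + 1) * R := by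
    refine (h2 b₀ _ s0 sh).trans ?_
    have : ∑ i ∈ Finset.range (ℓ + 1), supN (Ddot^[i] b₀) * gnorm N (ℓ - i) h ≤ (ℓ + 1) * R := by
      refine (Finset.sum_le_card_nsmul _ _ R ?_).trans (by simp)
      intro i hi
      have hi := Finset.mem_range.1 hi
      refine le_trans (mul_le_mul_of_nonneg_left
        (gnorm_le_normN N (l := ℓ - i) le_rfl h) (supN_nonneg _)) ?_
      exact hR b₀ (Or.inr (Or.inr rfl)) _ _ (by omega) (by omega) (by omega)
    have := mul_le_mul_of_nonneg_left this hC2.le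
    linarith
  have e4 : gnorm N ℓ (fun z => b₂ z * Del N h z)
      ≤ gnorm N ℓ (fun z => b₁ z * (z * deriv h z)) + gnorm N ℓ (fun z => b₀ z * h z)
        + gnorm N ℓ F := by
    rw [gnorm_local N ℓ heq]
    have a1 := gnorm_add hN2 ℓ ((s1.mul sZ).add (s0.mul sh)) sF
    have a2 := gnorm_add hN2 ℓ (s1.mul sZ) (s0.mul sh)
    linarith
  have cD := DD_cont N ℓ sD
  have cP := DD_cont N ℓ (s2.mul sD)
  have cM : Continuous (fun z => b₂ z * DD N ℓ (Del N h) z) := s2.cont.mul cD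
  have cS : Continuous (fun z => b₂ z * DD N ℓ (Del N h) z - DD N ℓ (fun z => b₂ z * Del N h z) z) :=
    cM.sub cP
  have e5 : gnorm N (ℓ + 2) h ≤ 2 * Xnorm N (fun z => b₂ z * DD N ℓ (Del N h) z) := by
    rw [gnorm_add_two, gnorm_eq]
    apply X_mono hN2 cD cM (by norm_num)
    intro z hz
    have := hb z ⟨hz.1.le, hz.2.le⟩
    rw [abs_mul, abs_of_pos (by linarith : 0 < b₂ z)]
    have := abs_nonneg (DD N ℓ (Del N h) z)
    nlinarith
  have e6 := X_add hN2 cS cP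
  simp only [sub_add_cancel] at e6
  have e7 : Xnorm N (fun z => b₂ z * DD N ℓ (Del N h) z - DD N ℓ (fun z => b₂ z * Del N h z) z)
      = Xnorm N (fun z => DD N ℓ (fun z => b₂ z * Del N h z) z - b₂ z * DD N ℓ (Del N h) z) := by
    unfold Xnorm
    congr 2
    funext z
    ring
  have e8 := h1 b₂ _ s2 sD
  have e9 := mul_le_mul_of_nonneg_left e1 hC1.le
  rw [gnorm_eq N ℓ (fun z => b₂ z * Del N h z)] at e4
  change _ ≤ _ + Xnorm N (DD N ℓ (fun z => b₂ z * Del N h z)) at e6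
  nlinarith

/-- The full norm is controlled by the top pieces. -/
lemma normN_le_sum (N : ℝ) (n : ℕ) (h : ℝ → ℝ) :
    normN N (n + 2) h ≤ normN N 1 h + ∑ ℓ ∈ Finset.range (n + 1), gnorm N (ℓ + 2) h := by
  have step : ∀ k, normN N (k + 1) h ≤ normN N k h + gnorm N (k + 1) h := by
    intro k
    have a := normN_sq_succ N k h
    have b := normN_nonneg N k h
    have c := gnorm_nonneg N (k + 1) h
    apply le_of_sq_le_sq _ (by positivity)
    nlinarith [mul_nonneg b c]
  induction n with
  | zero => simpa using step 1
  | succ n ih =>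
    rw [Finset.sum_range_succ]
    have := step (n + 2)
    linarith

/-- Elliptic estimate for fixed time. -/
lemma fixed_time {N : ℝ} (hN : 4 ≤ N) (n : ℕ) (M : ℝ) (hM : 0 < M) :
    ∃ C > (0:ℝ), ∀ b₂ b₁ b₀ h F : ℝ → ℝ,
    Sm b₂ → Sm b₁ → Sm b₀ → Sm h → Sm F → (∀ z ∈ Icc (0:ℝ) 1, 1 / 2 ≤ b₂ z) →
    (∀ z ∈ Ioo (0:ℝ) 1, b₂ z * Del N h z = b₁ z * (z * deriv h z) + b₀ z * h z + F z) →
    ∀ β E : ℝ, 1 ≤ β → (∀ b : ℝ → ℝ, (b = b₂ ∨ b = b₁ ∨ b = b₀) → supN (Ddot^[0] b) ≤ M ∧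
      supN (Ddot^[n + 1] b) ≤ β) → (∀ ℓ ≤ n, gnorm N ℓ F ≤ E) →
    normN N (n + 2) h ≤ C * (E + β * normN N 1 h) := by
  have hN2 : 2 ≤ N := by linarith
  choose K hK hlev using fun ℓ => level_bound hN ℓ
  obtain ⟨Cb, hCb, hb⟩ := b_interp n M hM
  set S := ∑ ℓ ∈ Finset.range (n + 1), K ℓ with hS
  have hS0 : 0 < S := Finset.sum_pos (fun i _ => hK i) ⟨0, by simp⟩
  obtain ⟨Cη, hCη, hh⟩ := h_interp hN2 n (1 / (2 * (S * Cb))) (by positivity)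
  refine ⟨2 * (1 + S * (Cb * Cη) + 2 * (n + 1)), by positivity, ?_⟩
  intro b₂ b₁ b₀ h F s2 s1 s0 sh sF hb2 heq β E hβ hbb hE
  have hβ0 : 0 < β := by linarith
  obtain ⟨L, hL, hLβ⟩ : ∃ L : ℝ, 1 ≤ L ∧ L ^ (n + 1) = β := by
    refine ⟨β ^ (1 / ((n + 1 : ℕ) : ℝ)), Real.one_le_rpow hβ (by positivity), ?_⟩
    rw [← Real.rpow_natCast, ← Real.rpow_mul hβ0.le, one_div_mul_cancel (by positivity), Real.rpow_one]
  set A := normN N (n + 2) h with hA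
  have hA0 : 0 ≤ A := normN_nonneg _ _ _
  set B := normN N 1 h with hB
  have hB0 : 0 ≤ B := normN_nonneg _ _ _
  set R := Cb * (1 / (2 * (S * Cb)) * A + Cη * (β * B)) with hR
  have hE0 : 0 ≤ E := (gnorm_nonneg _ _ _).trans (hE 0 (Nat.zero_le _))
  have hterm : ∀ b : ℝ → ℝ, (b = b₂ ∨ b = b₁ ∨ b = b₀) → ∀ i m : ℕ, i ≤ n + 1 → m ≤ n + 1 →
      i + m ≤ n + 2 → supN (Ddot^[i] b) * normN N m h ≤ R := by
    intro b hbm i m hi hm him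
    have sb : Sm b := by rcases hbm with rfl | rfl | rfl <;> assumption
    have q1 := hb b sb L hL (hbb b hbm).1 (by rw [hLβ]; exact (hbb b hbm).2) i hi
    have q2 := hh h sh L hL i m hi hm him
    rw [hLβ] at q2
    have q3 := mul_le_mul_of_nonneg_right q1 (normN_nonneg N m h)
    have q4 := mul_le_mul_of_nonneg_left q2 hCb.le
    linarith
  have hsum : ∑ ℓ ∈ Finset.range (n + 1), gnorm N (ℓ + 2) h
      ≤ ∑ ℓ ∈ Finset.range (n + 1), (K ℓ * R + 2 * E) := by
    apply Finset.sum_le_sum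
    intro ℓ hℓ
    have hℓ := Finset.mem_range.1 hℓ
    have := hlev ℓ b₂ b₁ b₀ h F s2 s1 s0 sh sF hb2 heq R
      (fun b hbm i m hi hm him => hterm b hbm i m (by omega) (by omega) (by omega))
    have := hE ℓ (by omega)
    linarith
  rw [Finset.sum_add_distrib, ← Finset.sum_mul, ← hS, Finset.sum_const, Finset.card_range,
    nsmul_eq_mul] at hsum
  push_cast at hsum
  have hmain := normN_le_sum N n h
  rw [← hA, ← hB] at hmain
  have hSR : S * R = A / 2 + S * (Cb * Cη) * (β * B) := by
    rw [hR]; field_simp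
  have t1 : B ≤ β * B := by nlinarith
  have t2 : 0 ≤ (S * (Cb * Cη)) * E := by positivity
  have t3 : 0 ≤ (2 * ((n:ℝ) + 1)) * (β * B) := by positivity
  nlinarith


lemma Sm_slice {y : ℝ → ℝ → ℝ} (h : ContDiff ℝ (⊤ : ℕ∞) (fun p : ℝ × ℝ => y p.1 p.2)) (t : ℝ) :
    Sm (y t) :=
  h.comp (contDiff_const.prodMk contDiff_id : ContDiff ℝ (⊤ : ℕ∞) (fun z : ℝ => (t, z)))

lemma dt_smooth {y : ℝ → ℝ → ℝ} (h : ContDiff ℝ (⊤ : ℕ∞) (fun p : ℝ × ℝ => y p.1 p.2)) :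
    ContDiff ℝ (⊤ : ℕ∞) (fun p : ℝ × ℝ => dt y p.1 p.2) := by
  have e : (fun p : ℝ × ℝ => dt y p.1 p.2)
      = fun p : ℝ × ℝ => fderiv ℝ (fun p : ℝ × ℝ => y p.1 p.2) p (1, 0) := by
    funext p
    have h1 : HasFDerivAt (fun p : ℝ × ℝ => y p.1 p.2)
        (fderiv ℝ (fun p : ℝ × ℝ => y p.1 p.2) (p.1, p.2)) (p.1, p.2) :=
      (h.differentiable (by simp) _).hasFDerivAt
    have h2 : HasDerivAt (fun s : ℝ => (s, p.2)) ((1:ℝ), (0:ℝ)) p.1 :=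
      (hasDerivAt_id _).prodMk (hasDerivAt_const _ _)
    exact (h1.comp_hasDerivAt p.1 h2).deriv
  rw [e]
  exact (h.fderiv_right (by simp)).clm_apply contDiff_const

lemma supT_nonneg (T : ℝ) (y : ℝ → ℝ → ℝ) : 0 ≤ supT T y :=
  Real.iSup_nonneg fun _ => Real.iSup_nonneg fun _ => abs_nonneg _

lemma supNT_nonneg (T : ℝ) (n : ℕ) (y : ℝ → ℝ → ℝ) : 0 ≤ supNT T n y :=
  Real.iSup_nonneg fun _ => supT_nonneg _ _

lemma sup_le_supNT {T : ℝ} (n : ℕ) {y : ℝ → ℝ → ℝ}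
    (h : ContDiff ℝ (⊤ : ℕ∞) (fun p : ℝ × ℝ => y p.1 p.2)) {t : ℝ} (ht : t ∈ Icc (0:ℝ) T) :
    supN (Ddot^[0] (y t)) ≤ supNT T n y := by
  have f1 : Finite {p : ℕ × ℕ // p.1 + p.2 ≤ n} := by
    apply Set.Finite.to_subtype
    apply ((Set.finite_Iic n).prod (Set.finite_Iic n)).subset
    intro p hp
    have hp : p.1 + p.2 ≤ n := hp
    exact ⟨by simp only [mem_Iic]; omega, by simp only [mem_Iic]; omega⟩
  have h1 : supT T y ≤ supNT T n y :=
    le_ciSup (f := fun p : {p : ℕ × ℕ // p.1 + p.2 ≤ n} =>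
      supT T (fun t => Ddot^[p.1.2] (dt^[p.1.1] y t))) (Set.finite_range _).bddAbove
      ⟨(0, 0), Nat.zero_le _⟩
  refine le_trans ?_ h1
  obtain ⟨c, hc⟩ := ((isCompact_Icc (a := (0:ℝ)) (b := T)).prod
    (isCompact_Icc (a := (0:ℝ)) (b := 1))).exists_bound_of_continuousOn h.continuous.continuousOn
  have hc0 : ∀ s ∈ Icc (0:ℝ) T, supN (y s) ≤ c := by
    intro s hs
    apply ciSup_le
    intro z
    exact hc (s, z.1) ⟨hs, z.2⟩
  exact le_ciSup (f := fun s : Icc (0:ℝ) T => supN (y s.1))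
    ⟨c, by rintro _ ⟨s, rfl⟩; exact hc0 s.1 s.2⟩ ⟨t, ht⟩

lemma sup_le_supLow {k n : ℕ} (h : k ≤ n) (b : ℝ → ℝ) : supN (Ddot^[k] b) ≤ supLow n b :=
  Finset.single_le_sum (f := fun k => supN (Ddot^[k] b)) (fun _ _ => supN_nonneg _)
    (Finset.mem_range.2 (by omega))

lemma supLow_nonneg (n : ℕ) (b : ℝ → ℝ) : 0 ≤ supLow n b :=
  Finset.sum_nonneg fun _ _ => supN_nonneg _

lemma ZZ_split (N : ℝ) (n : ℕ) (H : ℝ → ℝ → ℝ) (t : ℝ) :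
    ZZ N (n + 2) H t = ZZ N (n + 1) (dt H) t + normN N (n + 2) (H t) := by
  unfold ZZ
  rw [Finset.sum_range_succ']
  congr 1
  apply Finset.sum_congr rfl
  intro j _
  rw [Function.iterate_succ_apply, show n + 2 - (j + 1) = n + 1 - j by omega]

lemma ZZ_ge (N : ℝ) (n : ℕ) (y : ℝ → ℝ → ℝ) (t : ℝ) :
    normN N n (dt y t) ≤ ZZ N (n + 1) y t := by
  have := Finset.single_le_sum (f := fun j => normN N (n + 1 - j) (dt^[j] y t))
    (s := Finset.range (n + 1 + 1)) (fun _ _ => normN_nonneg _ _ _)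
    (Finset.mem_range.2 (by omega : 1 < n + 1 + 1))
  exact this

lemma ZZ_nonneg (N : ℝ) (n : ℕ) (y : ℝ → ℝ → ℝ) (t : ℝ) : 0 ≤ ZZ N n y t :=
  Finset.sum_nonneg fun _ _ => normN_nonneg _ _ _


theorem stmt11 (N : ℝ) (hN : 4 ≤ N) (T : ℝ) (hT : 0 < T) (n : ℕ) (M : ℝ) (hM : 0 < M) :
    ∃ C > (0:ℝ), ∀ b₂ b₁ b₀ G H : ℝ → ℝ → ℝ, ∀ τ₂ : ℝ,
      ContDiff ℝ (⊤ : ℕ∞) (fun p : ℝ × ℝ => b₂ p.1 p.2) →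
      ContDiff ℝ (⊤ : ℕ∞) (fun p : ℝ × ℝ => b₁ p.1 p.2) →
      ContDiff ℝ (⊤ : ℕ∞) (fun p : ℝ × ℝ => b₀ p.1 p.2) →
      (∀ t ∈ Icc (0:ℝ) T, ∀ z ∈ Icc (0:ℝ) 1, |b₂ t z - 1| ≤ 1 / 2) →
      supNT T 6 b₂ + supNT T 6 b₁ + supNT T 6 b₀ ≤ M →
      τ₂ ∈ Ioo (0:ℝ) T →
      ContDiff ℝ (⊤ : ℕ∞) (fun p : ℝ × ℝ => G p.1 p.2) →
      (∀ t ∈ Icc (0:ℝ) τ₂, ∀ z : ℝ, G t z = 0) →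
      ContDiff ℝ (⊤ : ℕ∞) (fun p : ℝ × ℝ => H p.1 p.2) →
      (∀ t ∈ Icc (0:ℝ) T, ∀ z ∈ Ioo (0:ℝ) 1,
        dt (dt H) t z + opA N b₂ b₁ b₀ H t z = G t z) →
      (∀ t ∈ Icc (0:ℝ) T, H t 1 = 0) →
      (∀ t ∈ Icc (0:ℝ) τ₂, ∀ z : ℝ, H t z = 0) →
      ∀ t ∈ Icc (0:ℝ) T,
        ZZ N (n + 2) H t
          ≤ C * (ZZ N (n + 1) (dt H) t + normN N n (G t)
              + (1 + (supLow (n + 4) (b₂ t) + supLow (n + 4) (b₁ t) + supLow (n + 4) (b₀ t)))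
                  * normN N 1 (H t)) := by
  obtain ⟨C, hC, hfix⟩ := fixed_time hN n M hM
  refine ⟨C + 1, by positivity, ?_⟩
  intro b₂ b₁ b₀ G H τ₂ s2 s1 s0 hb2 hbM _ sG _ sH heq _ _ t ht
  have sHH := Sm_slice (dt_smooth (dt_smooth sH)) t
  have sGt := Sm_slice sG t
  have sHt := Sm_slice sH t
  have p2 := supLow_nonneg (n + 4) (b₂ t)
  have p1 := supLow_nonneg (n + 4) (b₁ t)
  have p0 := supLow_nonneg (n + 4) (b₀ t)
  set β := 1 + (supLow (n + 4) (b₂ t) + supLow (n + 4) (b₁ t) + supLow (n + 4) (b₀ t)) with hβ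
  have hmain := hfix (b₂ t) (b₁ t) (b₀ t) (H t) (fun z => dt (dt H) t z - G t z)
    (Sm_slice s2 t) (Sm_slice s1 t) (Sm_slice s0 t) sHt (sHH.sub sGt) ?_ ?_ β
    (normN N n (dt (dt H) t) + normN N n (G t)) (by linarith) ?_ ?_
  · rw [ZZ_split]
    have q1 := ZZ_ge N n (dt H) t
    have q2 := ZZ_nonneg N (n + 1) (dt H) t
    have q3 := normN_nonneg N n (G t)
    have q4 : 0 ≤ β * normN N 1 (H t) := mul_nonneg (by linarith) (normN_nonneg _ _ _)
    nlinarith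
  · intro z hz
    have := abs_le.1 (hb2 t ht z hz)
    linarith
  · intro z hz
    have := heq t ht z hz
    unfold opA at this
    linarith
  · have m2 := sup_le_supNT 6 s2 ht
    have m1 := sup_le_supNT 6 s1 ht
    have m0 := sup_le_supNT 6 s0 ht
    have k2 := supNT_nonneg T 6 b₂
    have k1 := supNT_nonneg T 6 b₁
    have k0 := supNT_nonneg T 6 b₀
    have l2 := sup_le_supLow (show n + 1 ≤ n + 4 by omega) (b₂ t)
    have l1 := sup_le_supLow (show n + 1 ≤ n + 4 by omega) (b₁ t)
    have l0 := sup_le_supLow (show n + 1 ≤ n + 4 by omega) (b₀ t)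
    rintro b (rfl | rfl | rfl)
    · exact ⟨by linarith, by linarith⟩
    · exact ⟨by linarith, by linarith⟩
    · exact ⟨by linarith, by linarith⟩
  · intro ℓ hℓ
    have := gnorm_sub (by linarith : 2 ≤ N) ℓ sHH sGt
    have := gnorm_le_normN N hℓ (dt (dt H) t)
    have := gnorm_le_normN N hℓ (G t)
    linarith
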